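/- arXiv:1407.6652 — 3 statements merged into one kernel-verified Lean document; each statement's English description precedes it below -/
import Mathlib

section
/- Assume the Hill setup and let c ∈ ℝ with c² ≠ 1, and set F(ν) := −c²T²(4 − Δ(ν)²)/(4Δ'(ν)²) where Δ'(ν) ≠ 0. For every ε ∈ (0,1) and every δ > 0 there exists N > 0 such that for all ν < −N with sin(T·√(−ν))² ≥ ε: Δ'(ν) ≠ 0 and |F(ν) − c²ν| ≤ δ·|ν| (i.e., F(ν) − ν = (c²−1)ν up to an error of size at most δ|ν|). Consequently, for every ε ∈ (0,1) there exists N > 0 such that for all ν < −N with sin(T·√(−ν))² ≥ ε, the quantity F(ν) − ν has the same sign as 1 − c², i.e., (F(ν) − ν)·(1 − c²) > 0. -/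
open Real Filter Set

noncomputable section

/-- The (Floquet) spectrum of the linearized Klein--Gordon spectral problem
`(c^2-1) w'' - 2 c lam w' + (lam^2 + Q z) w = 0`: the set of `lam : ℂ` for which
there is a nontrivial bounded solution `w : ℝ → ℂ`. -/
def KGSpectrum (c : ℝ) (Q : ℝ → ℝ) : Set ℂ :=
  {lam : ℂ | ∃ w wd wdd : ℝ → ℂ,
    (∀ z, HasDerivAt w (wd z) z) ∧ (∀ z, HasDerivAt wd (wdd z) z) ∧
    (∀ z : ℝ, ((c : ℂ) ^ 2 - 1) * wdd z - 2 * (c : ℂ) * lam * wd z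
        + (lam ^ 2 + (Q z : ℂ)) * w z = 0) ∧
    (∃ z, w z ≠ 0) ∧ (∃ M : ℝ, ∀ z, ‖w z‖ ≤ M)}

/-- The wave exhibits a dynamical Hamiltonian–Hopf instability at `lam` if every
neighborhood of `lam` contains a point of the spectrum that is not purely imaginary. -/
def HasDHHInstabilityAt (c : ℝ) (Q : ℝ → ℝ) (lam : ℂ) : Prop :=
  ∀ U ∈ nhds lam, ∃ μ ∈ KGSpectrum c Q, μ ∈ U ∧ μ.re ≠ 0

/-- `y1, y2` (with derivatives `y1d, y2d`) are the canonical fundamental solutions of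
Hill's equation `y'' + P y = ν y` with `y1(0)=1, y1'(0)=0, y2(0)=0, y2'(0)=1`,
for every value of the spectral parameter `ν`. -/
def IsHillFundamental (P : ℝ → ℝ) (y1 y1d y2 y2d : ℝ → ℝ → ℝ) : Prop :=
  ∀ ν : ℝ,
    (∀ z, HasDerivAt (y1 ν) (y1d ν z) z) ∧
    (∀ z, HasDerivAt (y1d ν) (ν * y1 ν z - P z * y1 ν z) z) ∧
    (∀ z, HasDerivAt (y2 ν) (y2d ν z) z) ∧
    (∀ z, HasDerivAt (y2d ν) (ν * y2 ν z - P z * y2 ν z) z) ∧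
    y1 ν 0 = 1 ∧ y1d ν 0 = 0 ∧ y2 ν 0 = 0 ∧ y2d ν 0 = 1


/-- Gronwall estimate for a perturbed oscillator. -/
lemma osc_bound {T M om ep : ℝ} (hM : 0 ≤ M) (hom : 1 ≤ om) (hep : 0 ≤ ep)
    {u ud p g : ℝ → ℝ}
    (hu : ∀ z, HasDerivAt u (ud z) z)
    (hud : ∀ z, HasDerivAt ud (-(om ^ 2) * u z - p z * u z + g z) z)
    (hp : ∀ z ∈ Icc 0 T, |p z| ≤ M) (hg : ∀ z ∈ Icc 0 T, |g z| ≤ ep) :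
    ∀ z ∈ Icc 0 T, om * |u z| ≤ (om * |u 0| + |ud 0| + ep) * Real.exp ((M + 1) * T) ∧
      |ud z| ≤ (om * |u 0| + |ud 0| + ep) * Real.exp ((M + 1) * T) := by
  have hom0 : 0 < om := by linarith
  set v : ℝ → ℂ := fun z => (ud z : ℂ) + Complex.I * om * (u z : ℂ) with hv
  set a : ℝ → ℂ := fun z => Complex.exp (-(Complex.I * om) * z) * v z with ha
  set a' : ℝ → ℂ := fun z => Complex.exp (-(Complex.I * om) * z) *
    ((-(p z * u z) + g z : ℝ) : ℂ) with ha'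
  have hexp : ∀ z : ℝ, ‖Complex.exp (-(Complex.I * om) * z)‖ = 1 := by
    intro z
    rw [Complex.norm_exp]
    simp
  have hna : ∀ z, ‖a z‖ = ‖v z‖ := by
    intro z; simp only [ha, norm_mul, hexp, one_mul]
  have hda : ∀ z, HasDerivAt a (a' z) z := by
    intro z
    have h1 : HasDerivAt (fun z : ℝ => Complex.exp (-(Complex.I * om) * z))
        (Complex.exp (-(Complex.I * om) * z) * (-(Complex.I * om) * 1)) z := by
      have h0 : HasDerivAt (fun z : ℝ => -(Complex.I * om) * (z : ℂ)) (-(Complex.I * om) * 1) z :=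
        (Complex.ofRealCLM.hasDerivAt (x := z)).const_mul _
      exact h0.cexp
    have h2 : HasDerivAt v (((-(om ^ 2) * u z - p z * u z + g z : ℝ) : ℂ) +
        Complex.I * om * ((ud z : ℝ) : ℂ)) z :=
      (hud z).ofReal_comp.add ((hu z).ofReal_comp.const_mul _)
    have h3 := h1.mul h2
    refine h3.congr_deriv ?_
    simp only [ha', hv]
    push_cast
    linear_combination (-Complex.exp (-(Complex.I * om) * z) * om ^ 2 * u z) * Complex.I_sq
  have hre : ∀ z, |ud z| ≤ ‖v z‖ := by
    intro z
    have := Complex.abs_re_le_norm (v z)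
    simpa [hv] using this
  have him : ∀ z, om * |u z| ≤ ‖v z‖ := by
    intro z
    have := Complex.abs_im_le_norm (v z)
    simpa [hv, abs_mul, abs_of_pos hom0] using this
  have h0 : ‖a 0‖ ≤ om * |u 0| + |ud 0| := by
    rw [hna]
    refine (norm_add_le _ _).trans ?_
    simp [abs_of_pos hom0]
    linarith
  have hb : ∀ z ∈ Ico 0 T, ‖a' z‖ ≤ (M + 1) * ‖a z‖ + ep := by
    intro z hz
    have hz' : z ∈ Icc 0 T := ⟨hz.1, hz.2.le⟩
    simp only [ha', norm_mul, hexp, one_mul, Complex.norm_real, Real.norm_eq_abs]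
    rw [hna]
    have h1 : |-(p z * u z) + g z| ≤ |p z| * |u z| + |g z| := by
      refine (abs_add_le _ _).trans ?_
      rw [abs_neg, abs_mul]
    have h2 : |u z| ≤ ‖v z‖ := by
      have := him z
      nlinarith [abs_nonneg (u z)]
    have h3 : |p z| * |u z| ≤ M * ‖v z‖ :=
      mul_le_mul (hp z hz') h2 (abs_nonneg _) hM
    have := hg z hz'
    have := norm_nonneg (v z)
    linarith
  have key := norm_le_gronwallBound_of_norm_deriv_right_le (f := a) (f' := a')
    (fun z _ => (hda z).continuousAt.continuousWithinAt)
    (fun z _ => (hda z).hasDerivWithinAt) h0 hb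
  intro z hz
  have hk := key z hz
  rw [hna, gronwallBound_of_K_ne_0 (by linarith), sub_zero] at hk
  have hE1 : Real.exp ((M + 1) * z) ≤ Real.exp ((M + 1) * T) := by
    apply Real.exp_le_exp.2
    exact mul_le_mul_of_nonneg_left hz.2 (by linarith)
  have hE0 : 1 ≤ Real.exp ((M + 1) * z) := Real.one_le_exp (mul_nonneg (by linarith) hz.1)
  have hdiv : ep / (M + 1) ≤ ep := div_le_self hep (by linarith)
  have hfin : ‖v z‖ ≤ (om * |u 0| + |ud 0| + ep) * Real.exp ((M + 1) * T) := by
    have hs : 0 ≤ om * |u 0| + |ud 0| := by positivity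
    have e1 := mul_le_mul_of_nonneg_left hE1 hs
    have e2 : ep / (M + 1) * (Real.exp ((M + 1) * z) - 1) ≤ ep * Real.exp ((M + 1) * T) :=
      mul_le_mul hdiv (by linarith) (by linarith) hep
    linarith
  exact ⟨(him z).trans hfin, (hre z).trans hfin⟩

lemma deriv_aux {f : ℝ → ℝ} {x d K : ℝ}
    (h : ∀ m, |m - x| ≤ 1 → |f m - f x - (m - x) * d| ≤ K * |m - x| ^ 2) : HasDerivAt f d x := by
  rw [hasDerivAt_iff_isLittleO]
  have h1 : (fun m => f m - f x - (m - x) • d) =O[nhds x] fun m => (m - x) ^ 2 := by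
    apply Asymptotics.IsBigO.of_bound K
    filter_upwards [Metric.closedBall_mem_nhds x one_pos] with m hm
    have := h m (by simpa [Real.dist_eq] using hm)
    simpa using this
  refine h1.trans_isLittleO ?_
  have : (fun m : ℝ => (m - x) ^ 2) = fun m => (m - x) * (m - x) := by ext; ring
  rw [this]
  have h2 : (fun m : ℝ => m - x) =o[nhds x] fun _ => (1 : ℝ) := by
    rw [Asymptotics.isLittleO_one_iff]
    have : Tendsto (fun m : ℝ => m - x) (nhds x) (nhds (x - x)) := tendsto_id.sub_const x
    simpa using this
  simpa using h2.mul_isBigO (Asymptotics.isBigO_refl (fun m : ℝ => m - x) (nhds x))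

/-- The derivative with respect to the spectral parameter. -/
lemma param_deriv {T M om : ℝ} (hT : 0 < T) (hM : 0 ≤ M) (hom : 1 ≤ om) {P : ℝ → ℝ}
    (hP : ∀ z ∈ Icc 0 T, |P z| ≤ M)
    {y1 y1d y2 y2d : ℝ → ℝ → ℝ}
    (hfund : IsHillFundamental P y1 y1d y2 y2d)
    {u ud : ℝ → ℝ → ℝ}
    (hu : ∀ m z, HasDerivAt (u m) (ud m z) z)
    (hud : ∀ m z, HasDerivAt (ud m) (m * u m z - P z * u m z) z)
    (hu0 : ∀ m m', u m 0 = u m' 0) (hud0 : ∀ m m', ud m 0 = ud m' 0) :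
    ∃ d dd : ℝ → ℝ, (∀ z, HasDerivAt d (dd z) z) ∧
      (∀ z, HasDerivAt dd (-(om ^ 2) * d z - P z * d z + u (-(om ^ 2)) z) z) ∧
      d 0 = 0 ∧ dd 0 = 0 ∧
      HasDerivAt (fun m => u m T) (d T) (-(om ^ 2)) ∧
      HasDerivAt (fun m => ud m T) (dd T) (-(om ^ 2)) := by
  set n : ℝ := -(om ^ 2) with hn
  obtain ⟨h1, h1d, h2, h2d, i1, i1d, i2, i2d⟩ := hfund n
  have c1 : Continuous (y1 n) := continuous_iff_continuousAt.2 fun z => (h1 z).continuousAt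
  have c2 : Continuous (y2 n) := continuous_iff_continuousAt.2 fun z => (h2 z).continuousAt
  have cu : Continuous (u n) := continuous_iff_continuousAt.2 fun z => (hu n z).continuousAt
  have hW : ∀ z, y1 n z * y2d n z - y1d n z * y2 n z = 1 := by
    have hd : ∀ z, HasDerivAt (fun z => y1 n z * y2d n z - y1d n z * y2 n z) 0 z := by
      intro z
      refine (((h1 z).mul (h2d z)).sub ((h1d z).mul (h2 z))).congr_deriv ?_
      ring
    intro z
    have := is_const_of_deriv_eq_zero (fun z => (hd z).differentiableAt)
      (fun z => (hd z).deriv) z 0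
    simp only [i1, i1d, i2, i2d] at this
    linarith
  set A : ℝ → ℝ := fun z => ∫ s in (0:ℝ)..z, y1 n s * u n s with hA
  set B : ℝ → ℝ := fun z => ∫ s in (0:ℝ)..z, y2 n s * u n s with hB
  have hdA : ∀ z, HasDerivAt A (y1 n z * u n z) z := fun z =>
    intervalIntegral.integral_hasDerivAt_right ((c1.mul cu).intervalIntegrable _ _)
      ((c1.mul cu).stronglyMeasurableAtFilter _ _) (c1.mul cu).continuousAt
  have hdB : ∀ z, HasDerivAt B (y2 n z * u n z) z := fun z =>
    intervalIntegral.integral_hasDerivAt_right ((c2.mul cu).intervalIntegrable _ _)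
      ((c2.mul cu).stronglyMeasurableAtFilter _ _) (c2.mul cu).continuousAt
  set d : ℝ → ℝ := fun z => y2 n z * A z - y1 n z * B z with hd
  set dd : ℝ → ℝ := fun z => y2d n z * A z - y1d n z * B z with hdd
  have Hd : ∀ z, HasDerivAt d (dd z) z := by
    intro z
    refine (((h2 z).mul (hdA z)).sub ((h1 z).mul (hdB z))).congr_deriv ?_
    simp only [hdd]; ring
  have Hdd : ∀ z, HasDerivAt dd (n * d z - P z * d z + u n z) z := by
    intro z
    refine (((h2d z).mul (hdA z)).sub ((h1d z).mul (hdB z))).congr_deriv ?_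
    simp only [hd]
    linear_combination (u n z) * hW z
  have d0 : d 0 = 0 := by simp [hd, hA, hB]
  have dd0 : dd 0 = 0 := by simp [hdd, hA, hB]
  obtain ⟨S, hS⟩ := (isCompact_Icc (a := (0:ℝ)) (b := T)).exists_bound_of_continuousOn cu.continuousOn
  have hS0 : 0 ≤ S := (norm_nonneg _).trans (hS 0 ⟨le_rfl, hT.le⟩)
  set C := Real.exp ((M + 1 + 1) * T) with hC
  have hC0 : 0 < C := Real.exp_pos _
  have hw : ∀ m, |m - n| ≤ 1 → ∀ z ∈ Icc 0 T, |u m z - u n z| ≤ |m - n| * S * C := by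
    intro m hm z hz
    have := (osc_bound (T := T) (M := M + 1) (om := om) (ep := |m - n| * S) (by linarith) hom
      (by positivity) (u := fun z => u m z - u n z) (ud := fun z => ud m z - ud n z)
      (p := fun z => P z - (m - n)) (g := fun z => (m - n) * u n z)
      (fun z => (hu m z).sub (hu n z))
      (fun z => ((hud m z).sub (hud n z)).congr_deriv (by simp only [← hn]; ring))
      (fun z hz => (abs_sub _ _).trans (add_le_add (hP z hz) hm))
      (fun z hz => by
        rw [abs_mul]; exact mul_le_mul_of_nonneg_left (hS z hz) (abs_nonneg _)) z hz).1
    simp only [hu0 m n, hud0 m n, sub_self, abs_zero, mul_zero, zero_add, add_zero] at this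
    refine le_trans ?_ this
    exact le_mul_of_one_le_left (abs_nonneg _) hom
  have hR : ∀ m, |m - n| ≤ 1 → |u m T - u n T - (m - n) * d T| ≤ S * C * C * |m - n| ^ 2 ∧
      |ud m T - ud n T - (m - n) * dd T| ≤ S * C * C * |m - n| ^ 2 := by
    intro m hm
    have := (osc_bound (T := T) (M := M + 1) (om := om) (ep := |m - n| * (|m - n| * S * C))
      (by linarith) hom
      (by positivity) (u := fun z => u m z - u n z - (m - n) * d z)
      (ud := fun z => ud m z - ud n z - (m - n) * dd z)
      (p := P) (g := fun z => (m - n) * (u m z - u n z))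
      (fun z => ((hu m z).sub (hu n z)).sub ((Hd z).const_mul _))
      (fun z => (((hud m z).sub (hud n z)).sub ((Hdd z).const_mul _)).congr_deriv
        (by simp only [← hn]; ring))
      (fun z hz => (hP z hz).trans (by linarith))
      (fun z hz => by
        rw [abs_mul]; exact mul_le_mul_of_nonneg_left (hw m hm z hz) (abs_nonneg _)) T
        ⟨hT.le, le_rfl⟩)
    simp only [hu0 m n, hud0 m n, d0, dd0, sub_self, abs_zero, mul_zero, zero_add, add_zero] at this
    have e : |m - n| * (|m - n| * S * C) * Real.exp ((M + 1 + 1) * T) = S * C * C * |m - n| ^ 2 := by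
      rw [← hC]; ring
    rw [e] at this
    exact ⟨(le_mul_of_one_le_left (abs_nonneg _) hom).trans this.1, this.2⟩
  exact ⟨d, dd, Hd, Hdd, d0, dd0, deriv_aux fun m hm => (hR m hm).1,
    deriv_aux fun m hm => (hR m hm).2⟩

lemma chain {T M om r : ℝ} (hT : 0 < T) (hM : 0 ≤ M) (hom : 1 ≤ om) (hr : 0 ≤ r) {P : ℝ → ℝ}
    (hP : ∀ z ∈ Icc 0 T, |P z| ≤ M)
    {u ud v vd d dd f fd : ℝ → ℝ}
    (hu : ∀ z, HasDerivAt u (ud z) z)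
    (hud : ∀ z, HasDerivAt ud (-(om ^ 2) * u z - P z * u z) z)
    (hv : ∀ z, HasDerivAt v (vd z) z)
    (hvd : ∀ z, HasDerivAt vd (-(om ^ 2) * v z) z)
    (hd : ∀ z, HasDerivAt d (dd z) z)
    (hdd : ∀ z, HasDerivAt dd (-(om ^ 2) * d z - P z * d z + u z) z)
    (hf : ∀ z, HasDerivAt f (fd z) z)
    (hfd : ∀ z, HasDerivAt fd (-(om ^ 2) * f z + v z) z)
    (i1 : u 0 = v 0) (i2 : ud 0 = vd 0) (ir : om * |u 0| + |ud 0| = r)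
    (i3 : d 0 = 0) (i4 : dd 0 = 0) (i5 : f 0 = 0) (i6 : fd 0 = 0) :
    om * |u T - v T| ≤ r / om * (2 * M * Real.exp ((M + 1) * T) ^ 3) ∧
    |ud T - vd T| ≤ r / om * (2 * M * Real.exp ((M + 1) * T) ^ 3) ∧
    om * |d T - f T| ≤ r / om ^ 2 * (2 * M * Real.exp ((M + 1) * T) ^ 3) ∧
    |dd T - fd T| ≤ r / om ^ 2 * (2 * M * Real.exp ((M + 1) * T) ^ 3) := by
  have hom0 : 0 < om := by linarith
  have hTT : T ∈ Icc 0 T := ⟨hT.le, le_rfl⟩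
  set C := Real.exp ((M + 1) * T) with hC
  have hC1 : 1 ≤ C := Real.one_le_exp (by positivity)
  have hC0 : 0 < C := by linarith
  have bu : ∀ z ∈ Icc 0 T, |u z| ≤ r * C / om := by
    intro z hz
    have := (osc_bound (T := T) hM hom le_rfl hu (p := P) (g := fun _ => 0)
      (fun z => (hud z).congr_deriv (by ring)) hP (fun z _ => by simp) z hz).1
    rw [ir, add_zero, ← hC] at this
    rw [le_div_iff₀ hom0]; linarith
  have be : ∀ z ∈ Icc 0 T, om * |u z - v z| ≤ M * (r * C / om) * C ∧
      |ud z - vd z| ≤ M * (r * C / om) * C := by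
    intro z hz
    have := (osc_bound (T := T) (ep := M * (r * C / om)) hM hom (by positivity)
      (u := fun z => u z - v z) (ud := fun z => ud z - vd z)
      (p := fun _ => 0) (g := fun z => - (P z * u z))
      (fun z => (hu z).sub (hv z))
      (fun z => ((hud z).sub (hvd z)).congr_deriv (by ring))
      (fun z _ => by simpa using hM)
      (fun z hz => by
        rw [abs_neg, abs_mul]
        exact mul_le_mul (hP z hz) (bu z hz) (abs_nonneg _) hM) z hz)
    simpa [i1, i2, ← hC] using this
  have bd : ∀ z ∈ Icc 0 T, om * |d z| ≤ r * C / om * C := by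
    intro z hz
    have := (osc_bound (T := T) (ep := r * C / om) hM hom (by positivity) hd hdd hP bu z hz).1
    simpa [i3, i4, ← hC] using this
  have bE := osc_bound (T := T) (ep := 2 * M * r * C ^ 2 / om ^ 2) hM hom (by positivity)
      (u := fun z => d z - f z) (ud := fun z => dd z - fd z)
      (p := fun _ => 0) (g := fun z => - (P z * d z) + (u z - v z))
      (fun z => (hd z).sub (hf z))
      (fun z => ((hdd z).sub (hfd z)).congr_deriv (by ring))
      (fun z _ => by simpa using hM)
      (fun z hz => by
        refine (abs_add_le _ _).trans ?_
        rw [abs_neg, abs_mul]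
        have e1 := (be z hz).1
        have e2 := bd z hz
        have e3 : |d z| ≤ r * C ^ 2 / om ^ 2 := by
          rw [mul_comm, ← le_div_iff₀ hom0] at e2
          refine e2.trans_eq ?_
          field_simp
        have e4 : |u z - v z| ≤ M * r * C ^ 2 / om ^ 2 := by
          rw [mul_comm, ← le_div_iff₀ hom0] at e1
          refine e1.trans_eq ?_
          field_simp
        have e5 := mul_le_mul (hP z hz) e3 (abs_nonneg _) hM
        refine (add_le_add e5 e4).trans_eq ?_
        ring) T hTT
  simp only [i3, i4, i5, i6, sub_self, abs_zero, mul_zero, zero_add, ← hC] at bE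
  have eE : 2 * M * r * C ^ 2 / om ^ 2 * C = r / om ^ 2 * (2 * M * C ^ 3) := by ring
  rw [eE] at bE
  have ee : M * (r * C / om) * C ≤ r / om * (2 * M * C ^ 3) := by
    have h1 : M * (r * C / om) * C = r / om * (M * C ^ 2) := by ring
    rw [h1]
    apply mul_le_mul_of_nonneg_left _ (by positivity)
    have : M * C ^ 2 * 1 ≤ M * C ^ 2 * (2 * C) :=
      mul_le_mul_of_nonneg_left (by linarith) (by positivity)
    nlinarith
  exact ⟨(be T hTT).1.trans ee, (be T hTT).2.trans ee, bE.1, bE.2⟩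

lemma discr_asym {T : ℝ} (hT : 0 < T) {P : ℝ → ℝ} (hPcont : Continuous P)
    {y1 y1d y2 y2d : ℝ → ℝ → ℝ}
    (hfund : IsHillFundamental P y1 y1d y2 y2d) :
    ∃ K > 0, ∀ om : ℝ, 1 ≤ om →
      |(y1 (-(om ^ 2)) T + y2d (-(om ^ 2)) T) - 2 * Real.cos (T * om)| ≤ K / om ∧
      |om * deriv (fun n => y1 n T + y2d n T) (-(om ^ 2)) - T * Real.sin (T * om)| ≤ K / om := by
  obtain ⟨M, hM⟩ := (isCompact_Icc (a := (0:ℝ)) (b := T)).exists_bound_of_continuousOn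
    hPcont.continuousOn
  have hM0 : 0 ≤ M := (norm_nonneg _).trans (hM 0 ⟨le_rfl, hT.le⟩)
  have hP : ∀ z ∈ Icc 0 T, |P z| ≤ M := hM
  set L := 2 * M * Real.exp ((M + 1) * T) ^ 3 with hL
  have hL0 : 0 ≤ L := by positivity
  refine ⟨2 * L + 1, by linarith, fun om hom => ?_⟩
  have hom0 : 0 < om := by linarith
  have hne : om ≠ 0 := hom0.ne'
  obtain ⟨d, dd, a1, a2, a3, a4, a5, -⟩ := param_deriv hT hM0 hom hP hfund
    (fun m => (hfund m).1) (fun m => (hfund m).2.1)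
    (fun m m' => by rw [(hfund m).2.2.2.2.1, (hfund m').2.2.2.2.1])
    (fun m m' => by rw [(hfund m).2.2.2.2.2.1, (hfund m').2.2.2.2.2.1])
  obtain ⟨e, ed, b1, b2, b3, b4, -, b6⟩ := param_deriv hT hM0 hom hP hfund
    (fun m => (hfund m).2.2.1) (fun m => (hfund m).2.2.2.1)
    (fun m m' => by rw [(hfund m).2.2.2.2.2.2.1, (hfund m').2.2.2.2.2.2.1])
    (fun m m' => by rw [(hfund m).2.2.2.2.2.2.2, (hfund m').2.2.2.2.2.2.2])
  obtain ⟨h1, h1d, h2, h2d, i1, i1d, i2, i2d⟩ := hfund (-(om ^ 2))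
  have hc : ∀ z, HasDerivAt (fun z => Real.cos (om * z)) (-om * Real.sin (om * z)) z := by
    intro z
    have := ((hasDerivAt_id z).const_mul om).cos
    refine this.congr_deriv ?_
    simp; ring
  have hs : ∀ z, HasDerivAt (fun z => Real.sin (om * z)) (om * Real.cos (om * z)) z := by
    intro z
    have := ((hasDerivAt_id z).const_mul om).sin
    refine this.congr_deriv ?_
    simp; ring
  have r1 := chain (r := om) hT hM0 hom hom0.le hP h1 h1d hc
    (fun z => ((hs z).const_mul (-om)).congr_deriv (by ring)) a1 a2
    (f := fun z => z * Real.sin (om * z) / (2 * om))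
    (fd := fun z => (Real.sin (om * z) + z * (om * Real.cos (om * z))) / (2 * om))
    (fun z => (((hasDerivAt_id z).mul (hs z)).div_const _).congr_deriv (by simp))
    (fun z => (((hs z).add ((hasDerivAt_id z).mul ((hc z).const_mul om))).div_const _).congr_deriv
      (by simp; field_simp; ring))
    (by simp [i1]) (by simp [i1d]) (by simp [i1, i1d]) a3 a4 (by simp) (by simp)
  have r2 := chain (r := 1) hT hM0 hom zero_le_one hP h2 h2d
    (v := fun z => Real.sin (om * z) / om) (vd := fun z => Real.cos (om * z))
    (fun z => ((hs z).div_const om).congr_deriv (by field_simp))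
    (fun z => (hc z).congr_deriv (by field_simp)) b1 b2
    (f := fun z => (Real.sin (om * z) - om * (z * Real.cos (om * z))) / (2 * om ^ 3))
    (fd := fun z => z * Real.sin (om * z) / (2 * om))
    (fun z => (((hs z).sub (((hasDerivAt_id z).mul (hc z)).const_mul om)).div_const _).congr_deriv
      (by simp; field_simp; ring))
    (fun z => (((hasDerivAt_id z).mul (hs z)).div_const _).congr_deriv
      (by simp; field_simp; ring))
    (by simp [i2]) (by simp [i2d]) (by simp [i2, i2d]) b3 b4 (by simp) (by simp)
  rw [← hL] at r1 r2
  obtain ⟨p1, -, p3, -⟩ := r1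
  obtain ⟨-, q2, -, q4⟩ := r2
  have hder : HasDerivAt (fun n => y1 n T + y2d n T) (d T + ed T) (-(om ^ 2)) := a5.add b6
  rw [hder.deriv]
  rw [mul_comm T om]
  have s1 : |y1 (-(om ^ 2)) T - Real.cos (om * T)| ≤ L / om := by
    rw [le_div_iff₀ hom0, mul_comm]
    refine p1.trans_eq ?_
    field_simp
  have s2 : |y2d (-(om ^ 2)) T - Real.cos (om * T)| ≤ L / om := by
    refine q2.trans_eq ?_
    ring
  have s3 : |om * (d T - T * Real.sin (om * T) / (2 * om))| ≤ L / om := by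
    rw [abs_mul, abs_of_pos hom0]
    refine p3.trans_eq ?_
    field_simp
  have s4 : |om * (ed T - T * Real.sin (om * T) / (2 * om))| ≤ L / om := by
    rw [abs_mul, abs_of_pos hom0]
    refine (mul_le_mul_of_nonneg_left q4 hom0.le).trans_eq ?_
    field_simp
  have hK : (2 * L + 1) / om = L / om + L / om + 1 / om := by ring
  have h1o : 0 < 1 / om := by positivity
  rw [hK]
  constructor
  · have := abs_add_le (y1 (-(om ^ 2)) T - Real.cos (om * T)) (y2d (-(om ^ 2)) T - Real.cos (om * T))
    have e1 : (y1 (-(om ^ 2)) T + y2d (-(om ^ 2)) T) - 2 * Real.cos (om * T) =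
      (y1 (-(om ^ 2)) T - Real.cos (om * T)) + (y2d (-(om ^ 2)) T - Real.cos (om * T)) := by ring
    rw [e1]; linarith
  · have := abs_add_le (om * (d T - T * Real.sin (om * T) / (2 * om)))
      (om * (ed T - T * Real.sin (om * T) / (2 * om)))
    have e1 : om * (d T + ed T) - T * Real.sin (om * T) =
      om * (d T - T * Real.sin (om * T) / (2 * om)) +
      om * (ed T - T * Real.sin (om * T) / (2 * om)) := by field_simp; ring
    rw [e1]; linarith

/-- Pure algebra: the quotient estimate. -/
lemma quot_est {T K om ep s k D X c de : ℝ} (hT : 0 < T) (hK : 0 < K) (hom : 1 ≤ om)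
    (hep : 0 < ep) (hsk : s ^ 2 + k ^ 2 = 1) (hs : ep ≤ s ^ 2)
    (hD : |D - 2 * k| ≤ K / om) (hX : |om * X - T * s| ≤ K / om)
    (h1 : 4 * K ^ 2 ≤ T ^ 2 * ep * om)
    (h2 : c ^ 2 * (T ^ 2 * (4 * K + K ^ 2) + 8 * T * K + 4 * K ^ 2) ≤ de * (T ^ 2 * ep * om)) :
    X ≠ 0 ∧ |-(c ^ 2 * T ^ 2 * (4 - D ^ 2)) / (4 * X ^ 2) - c ^ 2 * (-(om ^ 2))| ≤ de * om ^ 2 := by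
  have hom0 : 0 < om := by linarith
  set a := D - 2 * k with ha
  set b := om * X - T * s with hb
  have hq : K / om ≤ K := div_le_self hK.le hom
  have hq0 : 0 < K / om := by positivity
  have hs1 : |s| ≤ 1 := abs_le_one_iff_mul_self_le_one.2 (by nlinarith)
  have hk1 : |k| ≤ 1 := abs_le_one_iff_mul_self_le_one.2 (by nlinarith)
  have hb2 : b ^ 2 ≤ K * (K / om) := by
    rw [← sq_abs]; nlinarith [abs_nonneg b]
  have ha2 : a ^ 2 ≤ K * (K / om) := by
    rw [← sq_abs]; nlinarith [abs_nonneg a]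
  have hb3 : K * (K / om) ≤ T ^ 2 * ep / 4 := by
    rw [mul_div_assoc', div_le_iff₀ hom0]; nlinarith
  have hoX : om * X = T * s + b := by rw [hb]; ring
  have hX2 : T ^ 2 * ep / 4 ≤ (om * X) ^ 2 := by
    have e1 : T ^ 2 * ep ≤ T ^ 2 * s ^ 2 := mul_le_mul_of_nonneg_left hs (by positivity)
    rw [hoX]
    nlinarith [sq_nonneg (T * s + 2 * b)]
  have hTe : 0 < T ^ 2 * ep := by positivity
  have hX0 : X ≠ 0 := by
    rintro rfl
    rw [mul_zero] at hX2
    nlinarith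
  refine ⟨hX0, ?_⟩
  have hka : |k * a| ≤ K / om := by
    rw [abs_mul]; nlinarith [abs_nonneg a, abs_nonneg k]
  have hsb : |s * b| ≤ K / om := by
    rw [abs_mul]; nlinarith [abs_nonneg b, abs_nonneg s]
  set n := T ^ 2 * (4 * (k * a) + a ^ 2) + 8 * T * (s * b) + 4 * b ^ 2 with hn
  have hnb : |n| ≤ (T ^ 2 * (4 * K + K ^ 2) + 8 * T * K + 4 * K ^ 2) / om := by
    have e : (T ^ 2 * (4 * K + K ^ 2) + 8 * T * K + 4 * K ^ 2) / om =
      T ^ 2 * (4 * (K / om) + K * (K / om)) + 8 * T * (K / om) + 4 * (K * (K / om)) := by ring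
    rw [e]
    obtain ⟨x1, x2⟩ := abs_le.1 hka
    obtain ⟨x3, x4⟩ := abs_le.1 hsb
    have z1 : T ^ 2 * (4 * (k * a) + a ^ 2) ≤ T ^ 2 * (4 * (K / om) + K * (K / om)) :=
      mul_le_mul_of_nonneg_left (by linarith) (by positivity)
    have z2 : T ^ 2 * (-(4 * (K / om) + K * (K / om))) ≤ T ^ 2 * (4 * (k * a) + a ^ 2) :=
      mul_le_mul_of_nonneg_left (by linarith [sq_nonneg a, mul_pos hK hq0]) (by positivity)
    have z3 := mul_le_mul_of_nonneg_left x4 hT.le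
    have z4 := mul_le_mul_of_nonneg_left x3 hT.le
    have hKK : 0 ≤ K * (K / om) := by positivity
    have hbb := sq_nonneg b
    rw [abs_le, hn]
    clear_value a b
    clear hn
    constructor <;> linarith
  have hmain : -(c ^ 2 * T ^ 2 * (4 - D ^ 2)) / (4 * X ^ 2) - c ^ 2 * (-(om ^ 2)) =
      om ^ 2 * (c ^ 2 * n / (4 * (om * X) ^ 2)) := by
    have hDk : D = 2 * k + a := by rw [ha]; ring
    have hnum : n = T ^ 2 * (D ^ 2 - 4) + 4 * (om * X) ^ 2 := by
      rw [hn, hDk, hoX]; linear_combination (-4 * T ^ 2) * hsk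
    rw [hnum]
    field_simp
    ring
  rw [hmain, abs_mul, abs_of_pos (by positivity : 0 < om ^ 2), mul_comm de]
  apply mul_le_mul_of_nonneg_left _ (by positivity)
  have hX20 : 0 < 4 * (om * X) ^ 2 := by positivity
  rw [abs_div, abs_of_pos hX20, abs_mul, abs_of_nonneg (sq_nonneg c), div_le_iff₀ hX20]
  have hde : 0 ≤ de := by
    by_contra hneg
    push Not at hneg
    have : 0 ≤ c ^ 2 * (T ^ 2 * (4 * K + K ^ 2) + 8 * T * K + 4 * K ^ 2) := by positivity
    have : de * (T ^ 2 * ep * om) < 0 := mul_neg_of_neg_of_pos hneg (by positivity)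
    linarith
  calc c ^ 2 * |n| ≤ c ^ 2 * ((T ^ 2 * (4 * K + K ^ 2) + 8 * T * K + 4 * K ^ 2) / om) :=
        mul_le_mul_of_nonneg_left hnb (sq_nonneg c)
    _ ≤ de * (T ^ 2 * ep) := by
        rw [mul_div_assoc', div_le_iff₀ hom0]; linarith
    _ ≤ de * (4 * (om * X) ^ 2) := mul_le_mul_of_nonneg_left (by linarith) hde

theorem F_minus_nu_asymptotics_at_minus_infinity
    (T : ℝ) (hT : 0 < T)
    (P : ℝ → ℝ) (hPcont : Continuous P) (hPper : ∀ z, P (z + T) = P z)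
    (y1 y1d y2 y2d : ℝ → ℝ → ℝ)
    (hfund : IsHillFundamental P y1 y1d y2 y2d)
    (Δ : ℝ → ℝ) (hΔ : Δ = fun ν => y1 ν T + y2d ν T)
    (c : ℝ) (hc : c ^ 2 ≠ 1)
    (F : ℝ → ℝ)
    (hF : F = fun ν => -(c ^ 2 * T ^ 2 * (4 - Δ ν ^ 2)) / (4 * (deriv Δ ν) ^ 2))
 :
    (∀ ε ∈ Set.Ioo (0 : ℝ) 1, ∀ δ > (0 : ℝ), ∃ N > (0 : ℝ), ∀ ν < -N,
      Real.sin (T * Real.sqrt (-ν)) ^ 2 ≥ ε →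
        deriv Δ ν ≠ 0 ∧ |F ν - c ^ 2 * ν| ≤ δ * |ν|) ∧
    (∀ ε ∈ Set.Ioo (0 : ℝ) 1, ∃ N > (0 : ℝ), ∀ ν < -N,
      Real.sin (T * Real.sqrt (-ν)) ^ 2 ≥ ε →
        (F ν - ν) * (1 - c ^ 2) > 0) := by
  have part1 : ∀ ε ∈ Set.Ioo (0 : ℝ) 1, ∀ δ > (0 : ℝ), ∃ N > (0 : ℝ), ∀ ν < -N,
      Real.sin (T * Real.sqrt (-ν)) ^ 2 ≥ ε →
        deriv Δ ν ≠ 0 ∧ |F ν - c ^ 2 * ν| ≤ δ * |ν| := by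
    intro ε hε δ hδ
    obtain ⟨K, hK, hasym⟩ := discr_asym hT hPcont hfund
    have hε0 : 0 < ε := hε.1
    set A := 4 * K ^ 2 / (T ^ 2 * ε) with hA
    set B := c ^ 2 * (T ^ 2 * (4 * K + K ^ 2) + 8 * T * K + 4 * K ^ 2) / (δ * (T ^ 2 * ε)) with hB
    have hA0 : 0 ≤ A := by positivity
    have hB0 : 0 ≤ B := by positivity
    refine ⟨(1 + A + B) ^ 2, by positivity, fun ν hν hsin => ?_⟩
    have hν0 : 0 ≤ -ν := by nlinarith [sq_nonneg (1 + A + B)]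
    set om := Real.sqrt (-ν) with hom
    have hνom : ν = -(om ^ 2) := by rw [hom, Real.sq_sqrt hν0]; ring
    have hbig : 1 + A + B ≤ om := Real.le_sqrt_of_sq_le (by linarith)
    have hom1 : 1 ≤ om := by linarith
    obtain ⟨g1, g2⟩ := hasym om hom1
    rw [← hνom] at g1 g2
    have hpos : 0 < T ^ 2 * ε := by positivity
    have k1 : 4 * K ^ 2 ≤ T ^ 2 * ε * om := by
      have : A ≤ om := by linarith
      rw [hA, div_le_iff₀ hpos] at this
      linarith
    have k2 : c ^ 2 * (T ^ 2 * (4 * K + K ^ 2) + 8 * T * K + 4 * K ^ 2) ≤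
        δ * (T ^ 2 * ε * om) := by
      have : B ≤ om := by linarith
      rw [hB, div_le_iff₀ (by positivity)] at this
      linarith
    have := quot_est (c := c) hT hK hom1 hε0 (Real.sin_sq_add_cos_sq (T * om)) hsin g1 g2 k1 k2
    rw [← hνom] at this
    have habs : |ν| = om ^ 2 := by rw [hνom, abs_neg, abs_of_nonneg (sq_nonneg om)]
    rw [habs, hF, hΔ]
    exact this
  refine ⟨part1, fun ε hε => ?_⟩
  have hc' : 1 - c ^ 2 ≠ 0 := fun h => hc (by linarith)
  have hc2 : 0 < |1 - c ^ 2| := abs_pos.2 hc'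
  obtain ⟨N, hN, h⟩ := part1 ε hε (|1 - c ^ 2| / 2) (by positivity)
  refine ⟨N, hN, fun ν hν hsin => ?_⟩
  have h2 := (h ν hν hsin).2
  have hν0 : ν < 0 := by linarith
  rw [abs_of_neg hν0] at h2
  have h3 : |(F ν - c ^ 2 * ν) * (1 - c ^ 2)| ≤ (1 - c ^ 2) ^ 2 / 2 * (-ν) := by
    rw [abs_mul, ← sq_abs (1 - c ^ 2)]
    nlinarith
  have h4 := (abs_le.1 h3).1
  have h5 : 0 < (1 - c ^ 2) ^ 2 * (-ν) := mul_pos (by positivity) (by linarith)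
  nlinarith
end
end

section
/- Assume the Hill setup. Then √(−ν)·Δ'(ν) − T·sin(T·√(−ν)) → 0 as ν → −∞, where Δ'(ν) denotes the derivative of the Hill discriminant with respect to ν. -/
open Real Filter Set

noncomputable section

lemma hill_aux_rot (T M ω : ℝ) (hω : 1 ≤ ω) (hM : 0 ≤ M)
    (P : ℝ → ℝ) (hP : ∀ z ∈ Icc 0 T, |P z| ≤ M) (y yd : ℝ → ℝ)
    (hy : ∀ z, HasDerivAt y (yd z) z)
    (hyd : ∀ z, HasDerivAt yd (-ω ^ 2 * y z - P z * y z) z)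
    (h0 : ‖(y 0 : ℂ) + Complex.I * ((yd 0 / ω : ℝ) : ℂ)‖ ≤ 1)
    (s : ℝ) (hs : s ∈ Icc 0 T) :
    ‖(y s : ℂ) + Complex.I * ((yd s / ω : ℝ) : ℂ)‖ ≤ Real.exp (M * T) ∧
    ‖((y s : ℂ) + Complex.I * ((yd s / ω : ℝ) : ℂ)) -
      ((y 0 : ℂ) + Complex.I * ((yd 0 / ω : ℝ) : ℂ)) * Complex.exp (-((ω * s : ℝ) : ℂ) * Complex.I)‖
      ≤ M * T * Real.exp (M * T) / ω := by
  have hω0 : 0 < ω := by linarith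
  have hωc : (ω : ℂ) ≠ 0 := by exact_mod_cast hω0.ne'
  set v : ℝ → ℂ := fun s => ((y s : ℂ) + Complex.I * ((yd s / ω : ℝ) : ℂ)) *
    Complex.exp (((ω * s : ℝ) : ℂ) * Complex.I) with hv
  set v' : ℝ → ℂ := fun s => -Complex.I * ((P s * y s / ω : ℝ) : ℂ) *
    Complex.exp (((ω * s : ℝ) : ℂ) * Complex.I) with hv'
  have hder : ∀ z, HasDerivAt v (v' z) z := by
    intro z
    have h1 : HasDerivAt (fun s => (y s : ℂ)) (yd z : ℂ) z := (hy z).ofReal_comp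
    have h2 : HasDerivAt (fun s => ((yd s / ω : ℝ) : ℂ))
        (((-ω ^ 2 * y z - P z * y z) / ω : ℝ) : ℂ) z := ((hyd z).div_const ω).ofReal_comp
    have h3 : HasDerivAt (fun s : ℝ => ((ω * s : ℝ) : ℂ)) ((ω * 1 : ℝ) : ℂ) z :=
      ((hasDerivAt_id z).const_mul ω).ofReal_comp
    have h4 := (h3.mul_const Complex.I).cexp
    have h5 := (h1.add (h2.const_mul Complex.I)).mul h4
    refine h5.congr_deriv ?_
    simp only [hv', Pi.add_apply]
    push_cast
    field_simp
    linear_combination ((ω : ℂ) * yd z) * Complex.I_sq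
  have hnv : ∀ z, ‖v z‖ = ‖(y z : ℂ) + Complex.I * ((yd z / ω : ℝ) : ℂ)‖ := by
    intro z
    simp only [hv, norm_mul, Complex.norm_exp_ofReal_mul_I, mul_one]
  have hyv : ∀ z, |y z| ≤ ‖v z‖ := by
    intro z
    rw [hnv]
    have := Complex.abs_re_le_norm ((y z : ℂ) + Complex.I * ((yd z / ω : ℝ) : ℂ))
    simpa using this
  have hb : ∀ z ∈ Icc 0 T, ‖v' z‖ ≤ M / ω * ‖v z‖ := by
    intro z hz
    simp only [hv', norm_mul, Complex.norm_exp_ofReal_mul_I, mul_one, norm_neg, Complex.norm_I,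
      one_mul, Complex.norm_real, Real.norm_eq_abs, abs_div, abs_mul, abs_of_pos hω0]
    rw [div_mul_eq_mul_div]
    gcongr
    · exact hP z hz
    · exact hyv z
  have hv0 : v 0 = (y 0 : ℂ) + Complex.I * ((yd 0 / ω : ℝ) : ℂ) := by simp [hv]
  have hT : 0 ≤ T := hs.1.trans hs.2
  have hgr : ∀ z ∈ Icc 0 T, ‖v z‖ ≤ Real.exp (M * T) := by
    intro z hz
    have := norm_le_gronwallBound_of_norm_deriv_right_le (f := v) (f' := v') (δ := 1)
      (K := M / ω) (ε := 0) (a := 0) (b := T)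
      (fun z _ => (hder z).continuousAt.continuousWithinAt)
      (fun z _ => (hder z).hasDerivWithinAt) (by rw [hv0]; exact h0)
      (fun z hz => by simpa using hb z ⟨hz.1, hz.2.le⟩) z hz
    rw [gronwallBound_ε0, one_mul, sub_zero] at this
    refine this.trans (Real.exp_le_exp.2 ?_)
    have h1 : M / ω ≤ M := div_le_self hM hω
    exact mul_le_mul h1 hz.2 hz.1 hM
  have hd : ‖v s - v 0‖ ≤ M / ω * Real.exp (M * T) * (s - 0) := by
    refine norm_image_sub_le_of_norm_deriv_le_segment' (f := v) (f' := v') (a := 0) (b := T)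
      (fun z _ => (hder z).hasDerivWithinAt) ?_ s hs
    intro z hz
    have hz' : z ∈ Icc 0 T := ⟨hz.1, hz.2.le⟩
    refine (hb z hz').trans ?_
    gcongr
    exact hgr z hz'
  refine ⟨by rw [← hnv]; exact hgr s hs, ?_⟩
  have hE : ((y s : ℂ) + Complex.I * ((yd s / ω : ℝ) : ℂ)) -
      ((y 0 : ℂ) + Complex.I * ((yd 0 / ω : ℝ) : ℂ)) * Complex.exp (-((ω * s : ℝ) : ℂ) * Complex.I)
      = (v s - v 0) * Complex.exp (((-(ω * s) : ℝ) : ℂ) * Complex.I) := by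
    rw [hv0, sub_mul]
    simp only [hv]
    rw [mul_assoc, ← Complex.exp_add]
    push_cast
    simp
  rw [hE, norm_mul, Complex.norm_exp_ofReal_mul_I, mul_one]
  refine hd.trans ?_
  rw [sub_zero]
  calc M / ω * Real.exp (M * T) * s ≤ M / ω * Real.exp (M * T) * T := by
        gcongr
        exact hs.2
    _ = _ := by ring

lemma hill_aux_y1 (T M ω : ℝ) (hω : 1 ≤ ω) (hM : 0 ≤ M)
    (P : ℝ → ℝ) (hP : ∀ z ∈ Icc 0 T, |P z| ≤ M) (y yd : ℝ → ℝ)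
    (hy : ∀ z, HasDerivAt y (yd z) z)
    (hyd : ∀ z, HasDerivAt yd (-ω ^ 2 * y z - P z * y z) z)
    (h0 : y 0 = 1) (h0' : yd 0 = 0)
    (s : ℝ) (hs : s ∈ Icc 0 T) :
    |y s| ≤ Real.exp (M * T) ∧ |yd s / ω| ≤ Real.exp (M * T) ∧
    |y s - Real.cos (ω * s)| ≤ M * T * Real.exp (M * T) / ω ∧
    |yd s / ω - -Real.sin (ω * s)| ≤ M * T * Real.exp (M * T) / ω := by
  obtain ⟨h1, h2⟩ := hill_aux_rot T M ω hω hM P hP y yd hy hyd (by simp [h0, h0']) s hs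
  have e : Complex.exp (-((ω * s : ℝ) : ℂ) * Complex.I) =
      (Real.cos (ω * s) : ℂ) - (Real.sin (ω * s) : ℂ) * Complex.I := by
    rw [Complex.exp_mul_I, Complex.cos_neg, Complex.sin_neg, Complex.ofReal_cos, Complex.ofReal_sin]
    ring
  rw [e, h0, h0'] at h2
  have a1 := (Complex.abs_re_le_norm _).trans h1
  have a2 := (Complex.abs_im_le_norm _).trans h1
  have a3 := (Complex.abs_re_le_norm _).trans h2
  have a4 := (Complex.abs_im_le_norm _).trans h2
  simp [-Complex.ofReal_div, -Complex.ofReal_cos, -Complex.ofReal_sin] at a1 a2 a3 a4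
  refine ⟨a1, a2, a3, ?_⟩
  simpa using a4

lemma hill_aux_y2 (T M ω : ℝ) (hω : 1 ≤ ω) (hM : 0 ≤ M)
    (P : ℝ → ℝ) (hP : ∀ z ∈ Icc 0 T, |P z| ≤ M) (y yd : ℝ → ℝ)
    (hy : ∀ z, HasDerivAt y (yd z) z)
    (hyd : ∀ z, HasDerivAt yd (-ω ^ 2 * y z - P z * y z) z)
    (h0 : y 0 = 0) (h0' : yd 0 = 1)
    (s : ℝ) (hs : s ∈ Icc 0 T) :
    |ω * y s| ≤ Real.exp (M * T) ∧ |yd s| ≤ Real.exp (M * T) ∧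
    |ω * y s - Real.sin (ω * s)| ≤ M * T * Real.exp (M * T) / ω ∧
    |yd s - Real.cos (ω * s)| ≤ M * T * Real.exp (M * T) / ω := by
  have hω0 : ω ≠ 0 := by linarith
  obtain ⟨h1, h2⟩ := hill_aux_rot T M ω hω hM P hP (fun s => ω * y s) (fun s => ω * yd s)
    (fun z => (hy z).const_mul ω)
    (fun z => ((hyd z).const_mul ω).congr_deriv (by ring)) (by simp [h0, h0', hω0]) s hs
  have e : Complex.exp (-((ω * s : ℝ) : ℂ) * Complex.I) =
      (Real.cos (ω * s) : ℂ) - (Real.sin (ω * s) : ℂ) * Complex.I := by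
    rw [Complex.exp_mul_I, Complex.cos_neg, Complex.sin_neg, Complex.ofReal_cos, Complex.ofReal_sin]
    ring
  have hc : ∀ x : ℝ, ω * x / ω = x := fun x => by field_simp
  simp only [hc] at h1 h2
  rw [e, h0, h0'] at h2
  have a1 := (Complex.abs_re_le_norm _).trans h1
  have a2 := (Complex.abs_im_le_norm _).trans h1
  have a3 := (Complex.abs_re_le_norm _).trans h2
  have a4 := (Complex.abs_im_le_norm _).trans h2
  simp [-Complex.ofReal_mul, -Complex.ofReal_cos, -Complex.ofReal_sin] at a1 a2 a3 a4
  exact ⟨by rw [abs_mul]; exact a1, a2, a3, a4⟩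

lemma hill_aux_triple (K ε a b c a' b' c' : ℝ) (hK : 1 ≤ K) (ha : |a| ≤ K) (hb : |b| ≤ K)
    (hb' : |b'| ≤ 1) (hc' : |c'| ≤ 1) (h1 : |a - a'| ≤ ε) (h2 : |b - b'| ≤ ε)
    (h3 : |c - c'| ≤ ε) : |a * b * c - a' * b' * c'| ≤ 3 * K ^ 2 * ε := by
  have hε : 0 ≤ ε := (abs_nonneg _).trans h1
  have e : a * b * c - a' * b' * c' = a * b * (c - c') + a * (b - b') * c' + (a - a') * b' * c' := by
    ring
  have t1 : |a * b * (c - c')| ≤ K * K * ε := by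
    rw [abs_mul, abs_mul]; gcongr
  have t2 : |a * (b - b') * c'| ≤ K * ε * 1 := by
    rw [abs_mul, abs_mul]; gcongr
  have t3 : |(a - a') * b' * c'| ≤ ε * 1 * 1 := by
    rw [abs_mul, abs_mul]; gcongr
  rw [e]
  have := abs_add_three (a * b * (c - c')) (a * (b - b') * c') ((a - a') * b' * c')
  have k1 : K * ε ≤ K ^ 2 * ε := by
    gcongr; nlinarith
  have k2 : ε ≤ K ^ 2 * ε := by nlinarith
  nlinarith

/-- The Wronskian-type quantity is differentiable in the spectral parameter. -/
lemma hill_aux_deriv (T ν K L : ℝ) (hT : 0 < T) (hν : ν < -1)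
    (P : ℝ → ℝ) (u ud : ℝ → ℝ) (y yd : ℝ → ℝ → ℝ)
    (hu : ∀ z, HasDerivAt u (ud z) z)
    (hud : ∀ z, HasDerivAt ud (ν * u z - P z * u z) z)
    (hy : ∀ μ z, HasDerivAt (y μ) (yd μ z) z)
    (hyd : ∀ μ z, HasDerivAt (yd μ) (μ * y μ z - P z * y μ z) z)
    (h0 : ∀ μ, y μ 0 = y ν 0) (h0' : ∀ μ, yd μ 0 = yd ν 0)
    (hK : ∀ s ∈ Icc 0 T, |u s| ≤ K)
    (hL : ∀ μ < -1, ∀ s ∈ Icc 0 T, |y μ s - y ν s| ≤ L * |μ - ν|)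
    (F : ℝ → ℝ) (hF0 : F 0 = 0) (hF : ∀ z, HasDerivAt F (u z * y ν z) z) :
    HasDerivAt (fun μ => u T * yd μ T - ud T * y μ T) (F T) ν := by
  have hK0 : 0 ≤ K := (abs_nonneg _).trans (hK 0 ⟨le_rfl, hT.le⟩)
  have key : ∀ μ < -1, |(u T * yd μ T - ud T * y μ T) - (u T * yd ν T - ud T * y ν T)
      - (μ - ν) * F T| ≤ K * L * T * (μ - ν) ^ 2 := by
    intro μ hμ
    have hd : ∀ z, HasDerivAt (fun s => (u s * yd μ s - ud s * y μ s) -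
        (u s * yd ν s - ud s * y ν s) - (μ - ν) * F s)
        ((μ - ν) * (u z * (y μ z - y ν z))) z := by
      intro z
      refine ((((hu z).mul (hyd μ z)).sub ((hud z).mul (hy μ z))).sub
        (((hu z).mul (hyd ν z)).sub ((hud z).mul (hy ν z)))
        |>.sub ((hF z).const_mul (μ - ν))).congr_deriv ?_
      ring
    have := norm_image_sub_le_of_norm_deriv_le_segment' (a := 0) (b := T)
      (C := |μ - ν| * (K * (L * |μ - ν|)))
      (fun z _ => (hd z).hasDerivWithinAt) (by
        intro z hz
        have hz' : z ∈ Icc 0 T := ⟨hz.1, hz.2.le⟩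
        rw [Real.norm_eq_abs, abs_mul, abs_mul]
        gcongr
        · exact hK z hz'
        · exact hL μ hμ z hz') T ⟨hT.le, le_rfl⟩
    simp only [h0 μ, h0' μ, hF0, Real.norm_eq_abs] at this
    calc _ = _ := by congr 1; ring
      _ ≤ _ := this
      _ = K * L * T * |μ - ν| ^ 2 := by ring
      _ = _ := by rw [sq_abs]
  rw [hasDerivAt_iff_isLittleO]
  have hO : (fun μ => (u T * yd μ T - ud T * y μ T) - (u T * yd ν T - ud T * y ν T)
      - (μ - ν) • F T) =O[nhds ν] fun μ => (μ - ν) ^ 2 := by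
    refine Asymptotics.IsBigO.of_bound (K * L * T) ?_
    filter_upwards [Iio_mem_nhds hν] with μ hμ
    simpa [abs_of_nonneg (sq_nonneg (μ - ν))] using key μ hμ
  refine hO.trans_isLittleO ?_
  have := (Asymptotics.isLittleO_pow_id (𝕜 := ℝ) (n := 2) (by norm_num)).comp_tendsto
    (show Tendsto (fun μ => μ - ν) (nhds ν) (nhds 0) from by
      have : Continuous fun μ : ℝ => μ - ν := by fun_prop
      simpa using this.tendsto ν)
  exact this

/-- Lipschitz dependence on the spectral parameter. -/
lemma hill_aux_lip (T ν K : ℝ) (hT : 0 < T)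
    (P : ℝ → ℝ) (u1 u1d u2 u2d : ℝ → ℝ) (y yd : ℝ → ℝ → ℝ)
    (hu1 : ∀ z, HasDerivAt u1 (u1d z) z)
    (hu1d : ∀ z, HasDerivAt u1d (ν * u1 z - P z * u1 z) z)
    (hu2 : ∀ z, HasDerivAt u2 (u2d z) z)
    (hu2d : ∀ z, HasDerivAt u2d (ν * u2 z - P z * u2 z) z)
    (hw : ∀ z, u1 z * u2d z - u1d z * u2 z = 1)
    (hy : ∀ μ z, HasDerivAt (y μ) (yd μ z) z)
    (hyd : ∀ μ z, HasDerivAt (yd μ) (μ * y μ z - P z * y μ z) z)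
    (h0 : ∀ μ, y μ 0 = y ν 0) (h0' : ∀ μ, yd μ 0 = yd ν 0)
    (hK1 : ∀ s ∈ Icc 0 T, |u1 s| ≤ K) (hK2 : ∀ s ∈ Icc 0 T, |u2 s| ≤ K)
    (hy_le : ∀ μ < -1, ∀ s ∈ Icc 0 T, |y μ s| ≤ K) (hν : ν < -1) :
    ∀ μ < -1, ∀ s ∈ Icc 0 T, |y μ s - y ν s| ≤ 2 * K ^ 3 * T * |μ - ν| := by
  intro μ hμ s hs
  have hK0 : 0 ≤ K := (abs_nonneg _).trans (hK1 0 ⟨le_rfl, hT.le⟩)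
  have W : ∀ u ud : ℝ → ℝ, (∀ z, HasDerivAt u (ud z) z) →
      (∀ z, HasDerivAt ud (ν * u z - P z * u z) z) → (∀ s ∈ Icc 0 T, |u s| ≤ K) →
      |(u s * yd μ s - ud s * y μ s) - (u s * yd ν s - ud s * y ν s)| ≤ |μ - ν| * K ^ 2 * T := by
    intro u ud hu hud hK
    have hd : ∀ z, HasDerivAt (fun s => (u s * yd μ s - ud s * y μ s) -
        (u s * yd ν s - ud s * y ν s))
        ((μ - ν) * (u z * y μ z)) z := by
      intro z
      refine ((((hu z).mul (hyd μ z)).sub ((hud z).mul (hy μ z))).sub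
        (((hu z).mul (hyd ν z)).sub ((hud z).mul (hy ν z)))).congr_deriv ?_
      ring
    have := norm_image_sub_le_of_norm_deriv_le_segment' (a := 0) (b := T)
      (C := |μ - ν| * (K * K))
      (fun z _ => (hd z).hasDerivWithinAt) (by
        intro z hz
        have hz' : z ∈ Icc 0 T := ⟨hz.1, hz.2.le⟩
        rw [Real.norm_eq_abs, abs_mul, abs_mul]
        gcongr
        · exact hK z hz'
        · exact hy_le μ hμ z hz') s hs
    simp only [h0 μ, h0' μ, Real.norm_eq_abs, sub_self, sub_zero] at this
    refine this.trans ?_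
    rw [sq]
    gcongr
    exact hs.2
  have w1 := W u1 u1d hu1 hu1d hK1
  have w2 := W u2 u2d hu2 hu2d hK2
  have e : y μ s - y ν s =
      u2 s * ((u1 s * yd μ s - u1d s * y μ s) - (u1 s * yd ν s - u1d s * y ν s)) -
      u1 s * ((u2 s * yd μ s - u2d s * y μ s) - (u2 s * yd ν s - u2d s * y ν s)) := by
    linear_combination (-(y μ s - y ν s)) * hw s
  rw [e]
  refine (abs_sub _ _).trans ?_
  rw [abs_mul, abs_mul]
  have a1 := mul_le_mul (hK2 s hs) w1 (abs_nonneg _) hK0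
  have a2 := mul_le_mul (hK1 s hs) w2 (abs_nonneg _) hK0
  linarith

theorem hill_discriminant_derivative_asymptotics
    (T : ℝ) (hT : 0 < T)
    (P : ℝ → ℝ) (hPcont : Continuous P) (hPper : ∀ z, P (z + T) = P z)
    (y1 y1d y2 y2d : ℝ → ℝ → ℝ)
    (hfund : IsHillFundamental P y1 y1d y2 y2d)
    (Δ : ℝ → ℝ) (hΔ : Δ = fun ν => y1 ν T + y2d ν T)
 :
    Filter.Tendsto
      (fun ν : ℝ => Real.sqrt (-ν) * deriv Δ ν - T * Real.sin (T * Real.sqrt (-ν)))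
      Filter.atBot (nhds 0) := by
  obtain ⟨M, hM⟩ := (isCompact_Icc (a := (0 : ℝ)) (b := T)).exists_bound_of_continuousOn
    hPcont.continuousOn
  have hP : ∀ z ∈ Icc 0 T, |P z| ≤ M := fun z hz => by simpa using hM z hz
  have hM0 : 0 ≤ M := (abs_nonneg _).trans (hP 0 ⟨le_rfl, hT.le⟩)
  have hTm : T ∈ Icc 0 T := ⟨hT.le, le_rfl⟩
  set K := Real.exp (M * T) with hKdef
  have hK1 : 1 ≤ K := Real.one_le_exp (by positivity)
  have hy1 : ∀ ν z, HasDerivAt (y1 ν) (y1d ν z) z := fun ν => (hfund ν).1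
  have hy1d : ∀ ν z, HasDerivAt (y1d ν) (ν * y1 ν z - P z * y1 ν z) z := fun ν => (hfund ν).2.1
  have hy2 : ∀ ν z, HasDerivAt (y2 ν) (y2d ν z) z := fun ν => (hfund ν).2.2.1
  have hy2d : ∀ ν z, HasDerivAt (y2d ν) (ν * y2 ν z - P z * y2 ν z) z :=
    fun ν => (hfund ν).2.2.2.1
  have i1 : ∀ ν, y1 ν 0 = 1 := fun ν => (hfund ν).2.2.2.2.1
  have i2 : ∀ ν, y1d ν 0 = 0 := fun ν => (hfund ν).2.2.2.2.2.1
  have i3 : ∀ ν, y2 ν 0 = 0 := fun ν => (hfund ν).2.2.2.2.2.2.1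
  have i4 : ∀ ν, y2d ν 0 = 1 := fun ν => (hfund ν).2.2.2.2.2.2.2
  have hw : ∀ ν z, y1 ν z * y2d ν z - y1d ν z * y2 ν z = 1 := by
    intro ν z
    have hd : ∀ z, HasDerivAt (fun z => y1 ν z * y2d ν z - y1d ν z * y2 ν z) 0 z := fun z =>
      (((hy1 ν z).mul (hy2d ν z)).sub ((hy1d ν z).mul (hy2 ν z))).congr_deriv (by ring)
    have := is_const_of_deriv_eq_zero (fun z => (hd z).differentiableAt)
      (fun z => (hd z).deriv) z 0
    simpa [i1, i2, i3, i4] using this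
  have hsq : ∀ ν < -1, 1 ≤ Real.sqrt (-ν) ∧ -(Real.sqrt (-ν)) ^ 2 = ν := by
    intro ν hν
    refine ⟨Real.one_le_sqrt.2 (by linarith), ?_⟩
    rw [Real.sq_sqrt (by linarith)]
    ring
  have A1 : ∀ ν < (-1 : ℝ), ∀ s ∈ Icc 0 T, _ := fun ν hν s hs =>
    hill_aux_y1 T M (Real.sqrt (-ν)) (hsq ν hν).1 hM0 P hP (y1 ν) (y1d ν) (hy1 ν)
      (by rw [(hsq ν hν).2]; exact hy1d ν) (i1 ν) (i2 ν) s hs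
  have A2 : ∀ ν < (-1 : ℝ), ∀ s ∈ Icc 0 T, _ := fun ν hν s hs =>
    hill_aux_y2 T M (Real.sqrt (-ν)) (hsq ν hν).1 hM0 P hP (y2 ν) (y2d ν) (hy2 ν)
      (by rw [(hsq ν hν).2]; exact hy2d ν) (i3 ν) (i4 ν) s hs
  have B1 : ∀ ν < -1, ∀ s ∈ Icc 0 T, |y1 ν s| ≤ K := fun ν hν s hs => (A1 ν hν s hs).1
  have B2 : ∀ ν < -1, ∀ s ∈ Icc 0 T, |y2 ν s| ≤ K := by
    intro ν hν s hs
    have h1 := (A2 ν hν s hs).1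
    have h2 := (hsq ν hν).1
    rw [abs_mul, abs_of_nonneg (by linarith)] at h1
    nlinarith [abs_nonneg (y2 ν s)]
  have main : ∀ ν < -1, |Real.sqrt (-ν) * deriv Δ ν - T * Real.sin (T * Real.sqrt (-ν))| ≤
      (12 * K ^ 2 * (M * T * K) * T) / Real.sqrt (-ν) := by
    intro ν hν
    have L1 := hill_aux_lip T ν K hT P (y1 ν) (y1d ν) (y2 ν) (y2d ν) y1 y1d (hy1 ν) (hy1d ν)
      (hy2 ν) (hy2d ν) (hw ν) hy1 hy1d (by simp [i1]) (by simp [i2]) (B1 ν hν) (B2 ν hν) B1 hν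
    have L2 := hill_aux_lip T ν K hT P (y1 ν) (y1d ν) (y2 ν) (y2d ν) y2 y2d (hy1 ν) (hy1d ν)
      (hy2 ν) (hy2d ν) (hw ν) hy2 hy2d (by simp [i3]) (by simp [i4]) (B1 ν hν) (B2 ν hν) B2 hν
    have c1 : Continuous (y1 ν) := continuous_iff_continuousAt.2 fun z => (hy1 ν z).continuousAt
    have c2 : Continuous (y2 ν) := continuous_iff_continuousAt.2 fun z => (hy2 ν z).continuousAt
    have prim : ∀ f : ℝ → ℝ, Continuous f → ∃ F : ℝ → ℝ, F 0 = 0 ∧ ∀ z, HasDerivAt F (f z) z :=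
      fun f hf => ⟨fun z => ∫ t in (0 : ℝ)..z, f t, by simp, fun z =>
        intervalIntegral.integral_hasDerivAt_right (hf.intervalIntegrable _ _)
          (hf.stronglyMeasurableAtFilter _ _) hf.continuousAt⟩
    obtain ⟨F11, z11, d11⟩ := prim (fun z => y1 ν z * y1 ν z) (by fun_prop)
    obtain ⟨F12, z12, d12⟩ := prim (fun z => y1 ν z * y2 ν z) (by fun_prop)
    obtain ⟨F21, z21, d21⟩ := prim (fun z => y2 ν z * y1 ν z) (by fun_prop)
    obtain ⟨F22, z22, d22⟩ := prim (fun z => y2 ν z * y2 ν z) (by fun_prop)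
    have D11 := hill_aux_deriv T ν K _ hT hν P (y1 ν) (y1d ν) y1 y1d (hy1 ν) (hy1d ν) hy1 hy1d
      (by simp [i1]) (by simp [i2]) (B1 ν hν) L1 F11 z11 d11
    have D12 := hill_aux_deriv T ν K _ hT hν P (y1 ν) (y1d ν) y2 y2d (hy1 ν) (hy1d ν) hy2 hy2d
      (by simp [i3]) (by simp [i4]) (B1 ν hν) L2 F12 z12 d12
    have D21 := hill_aux_deriv T ν K _ hT hν P (y2 ν) (y2d ν) y1 y1d (hy2 ν) (hy2d ν) hy1 hy1d
      (by simp [i1]) (by simp [i2]) (B2 ν hν) L1 F21 z21 d21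
    have D22 := hill_aux_deriv T ν K _ hT hν P (y2 ν) (y2d ν) y2 y2d (hy2 ν) (hy2d ν) hy2 hy2d
      (by simp [i3]) (by simp [i4]) (B2 ν hν) L2 F22 z22 d22
    have DD : HasDerivAt Δ (y2 ν T * F11 T - y1 ν T * F21 T +
        (y2d ν T * F12 T - y1d ν T * F22 T)) ν := by
      have h := ((D11.const_mul (y2 ν T)).sub (D21.const_mul (y1 ν T))).add
        ((D12.const_mul (y2d ν T)).sub (D22.const_mul (y1d ν T)))
      refine h.congr_of_eventuallyEq (Filter.Eventually.of_forall fun μ => ?_)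
      rw [hΔ]
      simp only [Pi.add_apply, Pi.sub_apply]
      linear_combination (-(y1 μ T) - y2d μ T) * hw ν T
    rw [DD.deriv]
    obtain ⟨hω, -⟩ := hsq ν hν
    have a1 := A1 ν hν
    have a2 := A2 ν hν
    set ω := Real.sqrt (-ν) with hωdef
    have hω0 : 0 < ω := by linarith
    set ε := M * T * K / ω with hε
    obtain ⟨p1, p2, p3, p4⟩ := a1 T hTm
    obtain ⟨q1, q2, q3, q4⟩ := a2 T hTm
    have hd : ∀ z, HasDerivAt (fun s => ω * (y2 ν T * F11 s - y1 ν T * F21 s +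
        (y2d ν T * F12 s - y1d ν T * F22 s)) - s * Real.sin (ω * T))
        (ω * y2 ν T * y1 ν z * y1 ν z - y1 ν T * (ω * y2 ν z) * y1 ν z
          + y2d ν T * y1 ν z * (ω * y2 ν z) - (y1d ν T / ω) * (ω * y2 ν z) * (ω * y2 ν z)
          - Real.sin (ω * T)) z := by
      intro z
      have h := ((((d11 z).const_mul (y2 ν T)).sub ((d21 z).const_mul (y1 ν T))).add
        (((d12 z).const_mul (y2d ν T)).sub ((d22 z).const_mul (y1d ν T))) |>.const_mul ω).sub
        ((hasDerivAt_id z).mul_const (Real.sin (ω * T)))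
      refine h.congr_deriv ?_
      field_simp
      ring
    have := norm_image_sub_le_of_norm_deriv_le_segment' (a := 0) (b := T)
      (C := 12 * K ^ 2 * ε)
      (fun z _ => (hd z).hasDerivWithinAt) (by
        intro z hz
        have hz' : z ∈ Icc 0 T := ⟨hz.1, hz.2.le⟩
        obtain ⟨r1, r2, r3, r4⟩ := a1 z hz'
        obtain ⟨t1, t2, t3, t4⟩ := a2 z hz'
        have sc := Real.abs_cos_le_one (ω * z)
        have ss := Real.abs_sin_le_one (ω * z)
        have k1 := hill_aux_triple K ε _ _ _ _ _ _ hK1 q1 r1 sc sc q3 r3 r3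
        have k2 := hill_aux_triple K ε _ _ _ _ _ _ hK1 p1 t1 ss sc p3 t3 r3
        have k3 := hill_aux_triple K ε _ _ _ _ _ _ hK1 q2 r1 sc ss q4 r3 t3
        have k4 := hill_aux_triple K ε _ _ _ _ _ _ hK1 p2 t1 ss ss p4 t3 t3
        have tr := Real.sin_sq_add_cos_sq (ω * z)
        have e0 : Real.sin (ω * T) * Real.cos (ω * z) * Real.cos (ω * z)
          - -Real.sin (ω * T) * Real.sin (ω * z) * Real.sin (ω * z) = Real.sin (ω * T) := by
          linear_combination Real.sin (ω * T) * tr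
        rw [abs_le] at k1 k2 k3 k4
        rw [Real.norm_eq_abs, abs_le]
        obtain ⟨k1, k1'⟩ := k1
        obtain ⟨k2, k2'⟩ := k2
        obtain ⟨k3, k3'⟩ := k3
        obtain ⟨k4, k4'⟩ := k4
        constructor <;> linarith) T hTm
    simp only [z11, z12, z21, z22, Real.norm_eq_abs] at this
    rw [mul_comm T ω]
    calc _ = _ := by congr 1; ring
      _ ≤ _ := this
      _ = _ := by rw [hε]; ring
  have hlim : Tendsto (fun ν : ℝ => (12 * K ^ 2 * (M * T * K) * T) / Real.sqrt (-ν))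
      atBot (nhds 0) :=
    (Real.tendsto_sqrt_atTop.comp tendsto_neg_atBot_atTop).const_div_atTop _
  refine squeeze_zero_norm' ?_ hlim
  filter_upwards [Iio_mem_atBot (-1 : ℝ)] with ν hν
  exact main ν hν
end
end

section
/- Assume the Klein–Gordon setup and let Δ be the Hill discriminant associated with P(z) = V''(f(z))/(c²−1) and period T. Suppose Δ'(0) ≠ 0, Δ'(0) ≠ c²T², and Δ'(0)·(c²−1)·(c²T² − Δ'(0)) < 0 (i.e., the product of the modulational instability index γ_M := sgn(Δ'(0)) and the parity index γ_P := sgn((c²−1)(c²T² − Δ'(0))) equals −1). Then there exists a nonzero β ∈ ℝ such that f exhibits a dynamical Hamiltonian–Hopf instability at iβ. -/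
open Real Filter Set

noncomputable section

/-! ### Second-order linear equations: Wronskians -/

/-- The function y with derivative yd solves the second-order equation with coefficient q. -/
def IsSolC (q y yd : ℝ → ℂ) : Prop :=
  (∀ z, HasDerivAt y (yd z) z) ∧ (∀ z, HasDerivAt yd (q z * y z) z)

lemma IsSolC.wronskian {q y yd v vd : ℝ → ℂ} (hy : IsSolC q y yd) (hv : IsSolC q v vd) (z : ℝ) :
    y z * vd z - yd z * v z = y 0 * vd 0 - yd 0 * v 0 := by
  have key : ∀ x, HasDerivAt (fun z => y z * vd z - yd z * v z) 0 x := by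
    intro x
    have := ((hy.1 x).mul (hv.2 x)).sub ((hy.2 x).mul (hv.1 x))
    refine this.congr_deriv ?_
    ring
  exact is_const_of_deriv_eq_zero (fun x => (key x).differentiableAt) (fun x => (key x).deriv) z 0

/-- canonical fundamental pair -/
structure IsFundC (q Y1 Y1d Y2 Y2d : ℝ → ℂ) : Prop where
  s1 : IsSolC q Y1 Y1d
  s2 : IsSolC q Y2 Y2d
  a1 : Y1 0 = 1
  b1 : Y1d 0 = 0
  a2 : Y2 0 = 0
  b2 : Y2d 0 = 1

lemma IsFundC.det {q Y1 Y1d Y2 Y2d : ℝ → ℂ} (h : IsFundC q Y1 Y1d Y2 Y2d) (z : ℝ) :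
    Y1 z * Y2d z - Y1d z * Y2 z = 1 := by
  rw [h.s1.wronskian h.s2 z, h.a1, h.b1, h.a2, h.b2]; ring

lemma IsFundC.rep {q Y1 Y1d Y2 Y2d y yd : ℝ → ℂ} (h : IsFundC q Y1 Y1d Y2 Y2d)
    (hy : IsSolC q y yd) (z : ℝ) :
    y z = y 0 * Y1 z + yd 0 * Y2 z ∧ yd z = y 0 * Y1d z + yd 0 * Y2d z := by
  have e2 := hy.wronskian h.s2 z
  have e1 := hy.wronskian h.s1 z
  have d := h.det z
  rw [h.a2, h.b2] at e2
  rw [h.a1, h.b1] at e1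
  constructor
  · linear_combination (-y z) * d + Y1 z * e2 - Y2 z * e1
  · linear_combination (-yd z) * d + Y1d z * e2 - Y2d z * e1

lemma IsSolC.lin {q y yd v vd : ℝ → ℂ} (hy : IsSolC q y yd) (hv : IsSolC q v vd) (a b : ℂ) :
    IsSolC q (fun z => a * y z + b * v z) (fun z => a * yd z + b * vd z) := by
  refine ⟨fun z => ((hy.1 z).const_mul a).add ((hv.1 z).const_mul b), fun z => ?_⟩
  refine (((hy.2 z).const_mul a).add ((hv.2 z).const_mul b)).congr_deriv ?_
  ring

lemma IsSolC.shift {q y yd : ℝ → ℂ} (hy : IsSolC q y yd) (T : ℝ) (hq : ∀ z, q (z + T) = q z) :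
    IsSolC q (fun z => y (z + T)) (fun z => yd (z + T)) := by
  refine ⟨fun z => (hy.1 (z+T)).comp_add_const z T, fun z => ?_⟩
  have := (hy.2 (z+T)).comp_add_const z T
  rwa [hq] at this

/-- Floquet solutions. -/
lemma IsFundC.floquet {q Y1 Y1d Y2 Y2d : ℝ → ℂ} (h : IsFundC q Y1 Y1d Y2 Y2d) (T : ℝ)
    (hq : ∀ z, q (z + T) = q z) (ρ : ℂ) (hρ0 : ρ ≠ 0) (hρ : Y1 T + Y2d T = ρ + ρ⁻¹) :
    ∃ y yd : ℝ → ℂ, IsSolC q y yd ∧ (∀ z, y (z + T) = ρ * y z) ∧ ∃ z, y z ≠ 0 := by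
  have hd := h.det T
  obtain ⟨a, b, hab, e1, e2⟩ : ∃ a b : ℂ, (a ≠ 0 ∨ b ≠ 0) ∧ a * Y1 T + b * Y2 T = ρ * a ∧
      a * Y1d T + b * Y2d T = ρ * b := by
    have hdet : (Y1 T - ρ) * (Y2d T - ρ) - Y1d T * Y2 T = 0 := by
      have : ρ * ρ⁻¹ = 1 := mul_inv_cancel₀ hρ0
      linear_combination hd - ρ * hρ + (-1) * this
    by_cases h2 : Y2 T = 0 ∧ Y1 T - ρ = 0
    · by_cases h3 : Y1d T = 0 ∧ Y2d T - ρ = 0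
      · refine ⟨1, 0, Or.inl one_ne_zero, ?_, ?_⟩
        · linear_combination h2.2
        · linear_combination h3.1
      · refine ⟨Y2d T - ρ, - Y1d T, ?_, ?_, ?_⟩
        · by_contra hcon; push Not at hcon
          exact h3 ⟨by linear_combination -hcon.2, hcon.1⟩
        · linear_combination hdet
        · ring
    · refine ⟨Y2 T, ρ - Y1 T, ?_, ?_, ?_⟩
      · by_contra hcon; push Not at hcon
        exact h2 ⟨hcon.1, by linear_combination -hcon.2⟩
      · ring
      · linear_combination -hdet
  have hs := h.s1.lin h.s2 a b
  refine ⟨_, _, hs, ?_, ?_⟩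
  · intro z
    have := (h.rep (hs.shift T hq) z).1
    simp only [zero_add] at this
    rw [this, e1, e2]; ring
  · by_contra hcon; push Not at hcon
    have y0 := hcon 0
    simp only [h.a1, h.a2] at y0
    have ha : a = 0 := by linear_combination y0
    have hz : (fun z => a * Y1 z + b * Y2 z) = fun _ => 0 := funext hcon
    have hd0 := hs.1 0
    rw [hz] at hd0
    have := hd0.unique (hasDerivAt_const _ _)
    simp only [h.b1, h.b2] at this
    have hb : b = 0 := by linear_combination this
    simp_all

/-! ### Construction of complex solutions as power series in the spectral parameter -/

def hillU (y1 y2 u0 : ℝ → ℝ) : ℕ → ℝ → ℝ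
  | 0 => u0
  | n + 1 => fun z => y2 z * (∫ t in (0:ℝ)..z, y1 t * hillU y1 y2 u0 n t)
      - y1 z * (∫ t in (0:ℝ)..z, y2 t * hillU y1 y2 u0 n t)

def hillUd (y1 y1d y2 y2d u0 u0d : ℝ → ℝ) : ℕ → ℝ → ℝ
  | 0 => u0d
  | n + 1 => fun z => y2d z * (∫ t in (0:ℝ)..z, y1 t * hillU y1 y2 u0 n t)
      - y1d z * (∫ t in (0:ℝ)..z, y2 t * hillU y1 y2 u0 n t)

def hillPrev (y1 y2 u0 : ℝ → ℝ) : ℕ → ℝ → ℝ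
  | 0 => fun _ => 0
  | n + 1 => hillU y1 y2 u0 n

structure RealFund (P y1 y1d y2 y2d : ℝ → ℝ) : Prop where
  h1 : ∀ z, HasDerivAt y1 (y1d z) z
  h1d : ∀ z, HasDerivAt y1d (- P z * y1 z) z
  h2 : ∀ z, HasDerivAt y2 (y2d z) z
  h2d : ∀ z, HasDerivAt y2d (- P z * y2 z) z
  det : ∀ z, y1 z * y2d z - y1d z * y2 z = 1

lemma cont_of_deriv {y yd : ℝ → ℝ} (h : ∀ z, HasDerivAt y (yd z) z) : Continuous y :=
  continuous_iff_continuousAt.2 fun z => (h z).continuousAt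

lemma hillU_cont {y1 y2 u0 : ℝ → ℝ} (c1 : Continuous y1) (c2 : Continuous y2)
    (c0 : Continuous u0) (n : ℕ) : Continuous (hillU y1 y2 u0 n) := by
  induction n with
  | zero => exact c0
  | succ n ih =>
    have i1 : Continuous fun z => ∫ t in (0:ℝ)..z, y1 t * hillU y1 y2 u0 n t :=
      intervalIntegral.continuous_primitive (fun a b => (c1.mul ih).intervalIntegrable a b) 0
    have i2 : Continuous fun z => ∫ t in (0:ℝ)..z, y2 t * hillU y1 y2 u0 n t :=
      intervalIntegral.continuous_primitive (fun a b => (c2.mul ih).intervalIntegrable a b) 0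
    exact (c2.mul i1).sub (c1.mul i2)

lemma hillU_deriv {P y1 y1d y2 y2d u0 u0d : ℝ → ℝ} (H : RealFund P y1 y1d y2 y2d)
    (h0 : ∀ z, HasDerivAt u0 (u0d z) z) (h0d : ∀ z, HasDerivAt u0d (- P z * u0 z) z) (n : ℕ) (z : ℝ) :
    HasDerivAt (hillU y1 y2 u0 n) (hillUd y1 y1d y2 y2d u0 u0d n z) z ∧
    HasDerivAt (hillUd y1 y1d y2 y2d u0 u0d n)
      (hillPrev y1 y2 u0 n z - P z * hillU y1 y2 u0 n z) z := by
  cases n with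
  | zero =>
    refine ⟨h0 z, ?_⟩
    refine (h0d z).congr_deriv ?_
    simp [hillPrev, hillU]
  | succ n =>
    have c1 := cont_of_deriv H.h1
    have c2 := cont_of_deriv H.h2
    have cu := hillU_cont c1 c2 (cont_of_deriv h0) n
    have i1 : HasDerivAt (fun z => ∫ t in (0:ℝ)..z, y1 t * hillU y1 y2 u0 n t)
        (y1 z * hillU y1 y2 u0 n z) z :=
      (c1.mul cu).integral_hasStrictDerivAt 0 z |>.hasDerivAt
    have i2 : HasDerivAt (fun z => ∫ t in (0:ℝ)..z, y2 t * hillU y1 y2 u0 n t)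
        (y2 z * hillU y1 y2 u0 n z) z :=
      (c2.mul cu).integral_hasStrictDerivAt 0 z |>.hasDerivAt
    constructor
    · refine (((H.h2 z).mul i1).sub ((H.h1 z).mul i2)).congr_deriv ?_
      simp only [hillUd]; ring
    · refine (((H.h2d z).mul i1).sub ((H.h1d z).mul i2)).congr_deriv ?_
      simp only [hillPrev, hillU]
      linear_combination (hillU y1 y2 u0 n z) * H.det z

lemma int_bound {g : ℝ → ℝ} {R A z : ℝ} {n : ℕ} (hz : |z| ≤ R)
    (hg : ∀ t, |t| ≤ R → |g t| ≤ A * |t| ^ n / n.factorial) :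
    |∫ t in (0:ℝ)..z, g t| ≤ A * |z| ^ (n + 1) / (n + 1).factorial := by
  rw [← Real.norm_eq_abs, intervalIntegral.norm_integral_eq_norm_integral_uIoc]
  have hb : ∀ t ∈ uIoc (0:ℝ) z, ‖g t‖ ≤ (A / n.factorial) * |t - 0| ^ n := by
    intro t ht
    have : |t| ≤ R := by
      refine le_trans ?_ hz
      have := abs_sub_left_of_mem_uIcc (uIoc_subset_uIcc ht)
      simpa using this
    have := hg t this
    rw [Real.norm_eq_abs, sub_zero]
    calc _ ≤ _ := this
      _ = _ := by ring
  have hint : MeasureTheory.IntegrableOn (fun t : ℝ => (A / n.factorial) * |t - 0| ^ n) (uIoc (0:ℝ) z) := by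
    apply (intervalIntegrable_iff).1
    apply Continuous.intervalIntegrable
    fun_prop
  have := MeasureTheory.norm_integral_le_of_norm_le (f := g) hint
    (MeasureTheory.ae_restrict_of_forall_mem measurableSet_uIoc hb)
  refine this.trans (le_of_eq ?_)
  rw [MeasureTheory.integral_const_mul, integral_pow_abs_sub_uIoc, Nat.factorial_succ]
  push_cast
  have : (n.factorial : ℝ) ≠ 0 := by positivity
  field_simp
  simp

lemma hillU_bound {y1 y1d y2 y2d u0 u0d : ℝ → ℝ} {R C : ℝ}
    (b1 : ∀ t, |t| ≤ R → |y1 t| ≤ C) (b1d : ∀ t, |t| ≤ R → |y1d t| ≤ C)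
    (b2 : ∀ t, |t| ≤ R → |y2 t| ≤ C) (b2d : ∀ t, |t| ≤ R → |y2d t| ≤ C)
    (b0 : ∀ t, |t| ≤ R → |u0 t| ≤ C) (b0d : ∀ t, |t| ≤ R → |u0d t| ≤ C) (hC : 0 ≤ C) (n : ℕ) :
    (∀ z, |z| ≤ R → |hillU y1 y2 u0 n z| ≤ C * (2 * C ^ 2) ^ n * |z| ^ n / n.factorial) ∧
    (∀ z, |z| ≤ R → |hillUd y1 y1d y2 y2d u0 u0d n z| ≤ C * (2 * C ^ 2) ^ n * |z| ^ n / n.factorial) := by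
  induction n with
  | zero => exact ⟨fun z hz => by simpa [hillU] using b0 z hz, fun z hz => by simpa [hillUd] using b0d z hz⟩
  | succ n ih =>
    have gen : ∀ (v : ℝ → ℝ), (∀ t, |t| ≤ R → |v t| ≤ C) → ∀ z, |z| ≤ R →
        |∫ t in (0:ℝ)..z, v t * hillU y1 y2 u0 n t| ≤
          (C * (C * (2 * C ^ 2) ^ n)) * |z| ^ (n + 1) / (n + 1).factorial := by
      intro v hv z hz
      refine int_bound hz fun t ht => ?_
      rw [abs_mul]
      calc |v t| * |hillU y1 y2 u0 n t| ≤ C * (C * (2 * C ^ 2) ^ n * |t| ^ n / n.factorial) :=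
            mul_le_mul (hv t ht) (ih.1 t ht) (abs_nonneg _) hC
        _ = _ := by ring
    have fin : ∀ p q a b z : ℝ, |p| ≤ C → |q| ≤ C →
        |a| ≤ (C * (C * (2 * C ^ 2) ^ n)) * |z| ^ (n + 1) / (n + 1).factorial →
        |b| ≤ (C * (C * (2 * C ^ 2) ^ n)) * |z| ^ (n + 1) / (n + 1).factorial →
        |p * a - q * b| ≤ C * (2 * C ^ 2) ^ (n + 1) * |z| ^ (n + 1) / (n + 1).factorial := by
      intro p q a b z hp hq ha hb
      have h1 := mul_le_mul hp ha (abs_nonneg _) hC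
      have h2 := mul_le_mul hq hb (abs_nonneg _) hC
      have h3 := abs_sub (p * a) (q * b)
      rw [abs_mul, abs_mul] at h3
      calc _ ≤ _ := h3
        _ ≤ _ := add_le_add h1 h2
        _ = _ := by ring
    exact ⟨fun z hz => fin _ _ _ _ z (b2 z hz) (b1 z hz) (gen _ b1 z hz) (gen _ b2 z hz),
      fun z hz => fin _ _ _ _ z (b2d z hz) (b1d z hz) (gen _ b1 z hz) (gen _ b2 z hz)⟩

lemma exists_abs_bound {g : ℝ → ℝ} (hg : Continuous g) (R : ℝ) :
    ∃ C, 0 ≤ C ∧ ∀ t, |t| ≤ R → |g t| ≤ C := by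
  obtain ⟨C, hC⟩ := (isCompact_Icc (a := -R) (b := R)).exists_bound_of_continuousOn hg.continuousOn
  exact ⟨|C|, abs_nonneg _, fun t ht => (hC t (abs_le.1 ht)).trans (le_abs_self C)⟩

/-- For each `R`, geometric/factorial bounds. -/
lemma hillU_bound' {P y1 y1d y2 y2d u0 u0d : ℝ → ℝ} (H : RealFund P y1 y1d y2 y2d)
    (h0 : ∀ z, HasDerivAt u0 (u0d z) z) (h0d : ∀ z, HasDerivAt u0d (- P z * u0 z) z) (R : ℝ) :
    ∃ C L : ℝ, 0 ≤ C ∧ 0 ≤ L ∧ ∀ n z, |z| ≤ R →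
      |hillU y1 y2 u0 n z| ≤ C * (L ^ n / n.factorial) ∧
      |hillUd y1 y1d y2 y2d u0 u0d n z| ≤ C * (L ^ n / n.factorial) := by
  obtain ⟨C1, p1, b1⟩ := exists_abs_bound (cont_of_deriv H.h1) R
  obtain ⟨C2, p2, b2⟩ := exists_abs_bound (cont_of_deriv H.h1d) R
  obtain ⟨C3, p3, b3⟩ := exists_abs_bound (cont_of_deriv H.h2) R
  obtain ⟨C4, p4, b4⟩ := exists_abs_bound (cont_of_deriv H.h2d) R
  obtain ⟨C5, p5, b5⟩ := exists_abs_bound (cont_of_deriv h0) R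
  obtain ⟨C6, p6, b6⟩ := exists_abs_bound (cont_of_deriv h0d) R
  set C := C1 + C2 + C3 + C4 + C5 + C6 with hCdef
  have hC : 0 ≤ C := by positivity
  have key := hillU_bound (R := R) (C := C)
    (fun t ht => (b1 t ht).trans (by linarith)) (fun t ht => (b2 t ht).trans (by linarith))
    (fun t ht => (b3 t ht).trans (by linarith)) (fun t ht => (b4 t ht).trans (by linarith))
    (fun t ht => (b5 t ht).trans (by linarith)) (fun t ht => (b6 t ht).trans (by linarith)) hC
  refine ⟨C, 2 * C ^ 2 * |R|, hC, by positivity, fun n z hz => ?_⟩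
  have : C * (2 * C ^ 2) ^ n * |z| ^ n / n.factorial ≤ C * ((2 * C ^ 2 * |R|) ^ n / n.factorial) := by
    rw [mul_pow (2 * C ^ 2) |R|, mul_assoc, mul_div_assoc]
    have hz' : |z| ≤ |R| := hz.trans (le_abs_self R)
    have := pow_le_pow_left₀ (abs_nonneg z) hz' n
    gcongr
  exact ⟨((key n).1 z hz).trans this, ((key n).2 z hz).trans this⟩

def hillY (U : ℕ → ℝ → ℝ) (ν : ℂ) (z : ℝ) : ℂ := ∑' n, ν ^ n * (U n z : ℂ)

lemma summ_exp (C L : ℝ) (ν : ℂ) : Summable fun n : ℕ => ‖ν‖ ^ n * (C * (L ^ n / n.factorial)) := by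
  have := (Real.summable_pow_div_factorial (‖ν‖ * L)).mul_left C
  refine this.congr fun n => ?_
  rw [mul_pow]; ring

lemma hillY_sol {P y1 y1d y2 y2d u0 u0d : ℝ → ℝ} (hP : Continuous P) (H : RealFund P y1 y1d y2 y2d)
    (h0 : ∀ z, HasDerivAt u0 (u0d z) z) (h0d : ∀ z, HasDerivAt u0d (- P z * u0 z) z) (ν : ℂ) :
    IsSolC (fun z => ν - P z) (hillY (hillU y1 y2 u0) ν) (hillY (hillUd y1 y1d y2 y2d u0 u0d) ν) := by
  have hder := hillU_deriv H h0 h0d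
  have smU : ∀ z, Summable fun n : ℕ => ν ^ n * (hillU y1 y2 u0 n z : ℂ) := by
    intro z
    obtain ⟨C, L, hC, hL, hb⟩ := hillU_bound' H h0 h0d |z|
    refine Summable.of_norm_bounded (summ_exp C L ν) fun n => ?_
    rw [norm_mul, norm_pow, Complex.norm_real]
    gcongr
    exact (hb n z le_rfl).1
  have smUd : ∀ z, Summable fun n : ℕ => ν ^ n * (hillUd y1 y1d y2 y2d u0 u0d n z : ℂ) := by
    intro z
    obtain ⟨C, L, hC, hL, hb⟩ := hillU_bound' H h0 h0d |z|
    refine Summable.of_norm_bounded (summ_exp C L ν) fun n => ?_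
    rw [norm_mul, norm_pow, Complex.norm_real]
    gcongr
    exact (hb n z le_rfl).2
  have hmem : ∀ z : ℝ, z ∈ Ioo (-(|z| + 1)) (|z| + 1) := by
    intro z; constructor
    · linarith [neg_abs_le z]
    · linarith [le_abs_self z]
  constructor
  · intro z
    obtain ⟨C, L, hC, hL, hb⟩ := hillU_bound' H h0 h0d (|z| + 1)
    refine hasDerivAt_tsum_of_isPreconnected (summ_exp C L ν) isOpen_Ioo isPreconnected_Ioo
      (g := fun n z => ν ^ n * (hillU y1 y2 u0 n z : ℂ))
      (g' := fun n z => ν ^ n * (hillUd y1 y1d y2 y2d u0 u0d n z : ℂ)) ?_ ?_ (hmem z) (smU z) (hmem z)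
    · intro n x hx
      exact ((hder n x).1.ofReal_comp).const_mul _
    · intro n x hx
      rw [norm_mul, norm_pow, Complex.norm_real]
      gcongr
      exact (hb n x (abs_le.2 ⟨hx.1.le, hx.2.le⟩)).2
  · intro z
    obtain ⟨C, L, hC, hL, hb⟩ := hillU_bound' H h0 h0d (|z| + 1)
    obtain ⟨A, hA, hPA⟩ := exists_abs_bound hP (|z| + 1)
    have smp : Summable fun n : ℕ => ‖ν‖ ^ n *
        ((match n with | 0 => 0 | m + 1 => C * (L ^ m / m.factorial)) + A * (C * (L ^ n / n.factorial))) := by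
      simp only [mul_add]
      refine Summable.add ?_ ?_
      · rw [← summable_nat_add_iff 1]
        refine ((summ_exp C L ν).mul_left ‖ν‖).congr fun n => ?_
        simp only [pow_succ]; ring
      · refine ((summ_exp C L ν).mul_left A).congr fun n => ?_
        ring
    have main := hasDerivAt_tsum_of_isPreconnected smp isOpen_Ioo isPreconnected_Ioo
      (g := fun n z => ν ^ n * (hillUd y1 y1d y2 y2d u0 u0d n z : ℂ))
      (g' := fun n z => ν ^ n * ((hillPrev y1 y2 u0 n z - P z * hillU y1 y2 u0 n z : ℝ) : ℂ))
      (fun n x hx => ((hder n x).2.ofReal_comp).const_mul _) ?_ (hmem z) (smUd z) (hmem z)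
    · refine main.congr_deriv (Eq.symm ?_)
      have e1 : Summable fun n : ℕ => ν ^ n * (hillPrev y1 y2 u0 n z : ℂ) := by
        rw [← summable_nat_add_iff 1]
        refine ((smU z).mul_left ν).congr fun n => ?_
        simp only [hillPrev, pow_succ]; ring
      have e2 : ∑' n : ℕ, ν ^ n * (hillPrev y1 y2 u0 n z : ℂ) = ν * hillY (hillU y1 y2 u0) ν z := by
        rw [e1.tsum_eq_zero_add, hillY, ← tsum_mul_left]
        simp only [hillPrev, Complex.ofReal_zero, mul_zero, zero_add]
        exact tsum_congr fun n => by rw [pow_succ]; ring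
      have e3 := e1.tsum_sub ((smU z).mul_left (P z : ℂ))
      rw [e2, tsum_mul_left] at e3
      rw [sub_mul]
      change _ = _ - _ * hillY (hillU y1 y2 u0) ν z at e3
      rw [← e3]
      refine tsum_congr fun n => ?_
      push_cast; ring
    · intro n x hx
      have hx' := abs_le.2 ⟨hx.1.le, hx.2.le⟩
      rw [norm_mul, norm_pow, Complex.norm_real, Real.norm_eq_abs]
      gcongr
      refine (abs_sub _ _).trans (add_le_add ?_ ?_)
      · cases n with
        | zero => simp [hillPrev]
        | succ m => exact (hb m x hx').1
      · rw [abs_mul]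
        exact mul_le_mul (hPA x hx') (hb n x hx').1 (abs_nonneg _) hA

lemma hillY_zero {y1 y1d y2 y2d u0 u0d : ℝ → ℝ} (ν : ℂ) :
    hillY (hillU y1 y2 u0) ν 0 = u0 0 ∧ hillY (hillUd y1 y1d y2 y2d u0 u0d) ν 0 = u0d 0 := by
  constructor
  · rw [hillY, tsum_eq_single 0]
    · simp [hillU]
    · intro n hn
      obtain ⟨m, rfl⟩ := Nat.exists_eq_succ_of_ne_zero hn
      simp [hillU]
  · rw [hillY, tsum_eq_single 0]
    · simp [hillUd]
    · intro n hn
      obtain ⟨m, rfl⟩ := Nat.exists_eq_succ_of_ne_zero hn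
      simp [hillUd]

lemma hillY_entire {U : ℕ → ℝ → ℝ} {z C L : ℝ}
    (hb : ∀ n, |U n z| ≤ C * (L ^ n / n.factorial)) :
    Differentiable ℂ fun ν => hillY U ν z := by
  intro ν
  have := Complex.differentiableOn_tsum_of_summable_norm (summ_exp C L ((‖ν‖ + 1 : ℝ) : ℂ))
    (F := fun n (ν : ℂ) => ν ^ n * (U n z : ℂ)) (U := Metric.ball 0 (‖ν‖ + 1)) ?_ Metric.isOpen_ball ?_
  · refine this.differentiableAt (Metric.isOpen_ball.mem_nhds ?_)
    simp
  · intro n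
    fun_prop
  · intro n w hw
    rw [norm_mul, norm_pow, Complex.norm_real, Real.norm_eq_abs, Complex.norm_real,
      Real.norm_of_nonneg (by positivity)]
    have : ‖w‖ ≤ ‖ν‖ + 1 := by simpa using (Metric.mem_ball.1 hw).le
    have := hb n
    gcongr

/-! ### Large-parameter asymptotics -/

lemma norm_exp_le {s : ℂ} (him : |s.im| ≤ 1) {z T : ℝ} (h0 : 0 ≤ z) (hz : z ≤ T) :
    ‖Complex.exp (Complex.I * s * z)‖ ≤ Real.exp T ∧
    ‖Complex.exp (-(Complex.I * s * z))‖ ≤ Real.exp T := by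
  obtain ⟨h1, h2⟩ := abs_le.1 him
  constructor
  · rw [Complex.norm_exp]
    apply Real.exp_le_exp.2
    simp
    nlinarith
  · rw [Complex.norm_exp]
    apply Real.exp_le_exp.2
    simp
    nlinarith

lemma sol_asym {P : ℝ → ℝ} {T A : ℝ} (hT : 0 < T) (hA0 : 0 < A)
    (hA : ∀ t, 0 ≤ t → t ≤ T → |P t| ≤ A) {s : ℂ} (him : |s.im| ≤ 1) (hs : 1 ≤ ‖s‖)
    {y yd : ℝ → ℂ} (hy : IsSolC (fun z => -s ^ 2 - P z) y yd) {B : ℝ}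
    (ha : ‖yd 0 + Complex.I * s * y 0‖ ≤ B) (hb : ‖yd 0 - Complex.I * s * y 0‖ ≤ B) :
    ‖Complex.exp (-(Complex.I * s * T)) * (yd T + Complex.I * s * y T)
      - (yd 0 + Complex.I * s * y 0)‖ ≤
        B * (A * Real.exp T ^ 2 * T * Real.exp (A * Real.exp T ^ 2 * T) / ‖s‖) ∧
    ‖Complex.exp (Complex.I * s * T) * (yd T - Complex.I * s * y T)
      - (yd 0 - Complex.I * s * y 0)‖ ≤
        B * (A * Real.exp T ^ 2 * T * Real.exp (A * Real.exp T ^ 2 * T) / ‖s‖) := by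
  have hB : 0 ≤ B := (norm_nonneg _).trans ha
  have hs0 : 0 < ‖s‖ := by linarith
  have hsne : s ≠ 0 := norm_pos_iff.1 hs0
  set α0 := yd 0 + Complex.I * s * y 0 with hα0
  set β0 := yd 0 - Complex.I * s * y 0 with hβ0
  let α : ℝ → ℂ := fun z => Complex.exp (-(Complex.I * s * z)) * (yd z + Complex.I * s * y z)
  let β : ℝ → ℂ := fun z => Complex.exp (Complex.I * s * z) * (yd z - Complex.I * s * y z)
  let α' : ℝ → ℂ := fun z => Complex.exp (-(Complex.I * s * z)) * (- P z * y z)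
  let β' : ℝ → ℂ := fun z => Complex.exp (Complex.I * s * z) * (- P z * y z)
  have hlin : ∀ z : ℝ, HasDerivAt (fun z : ℝ => Complex.I * s * (z : ℂ)) (Complex.I * s) z := by
    intro z
    simpa using (Complex.ofRealCLM.hasDerivAt (x := z)).const_mul (Complex.I * s)
  have dα : ∀ z, HasDerivAt α (α' z) z := by
    intro z
    have e := (hlin z).neg.cexp
    refine (e.mul ((hy.2 z).add ((hy.1 z).const_mul (Complex.I * s)))).congr_deriv ?_
    simp only [α', Pi.neg_apply, Pi.add_apply]
    linear_combination (- Complex.exp (-(Complex.I * s * z)) * s ^ 2 * y z) * Complex.I_sq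
  have dβ : ∀ z, HasDerivAt β (β' z) z := by
    intro z
    have e := (hlin z).cexp
    refine (e.mul ((hy.2 z).sub ((hy.1 z).const_mul (Complex.I * s)))).congr_deriv ?_
    simp only [β', Pi.sub_apply]
    linear_combination (- Complex.exp ((Complex.I * s * z)) * s ^ 2 * y z) * Complex.I_sq
  set k := A * Real.exp T ^ 2 / ‖s‖ with hk
  have hkpos : 0 < k := by positivity
  let v : ℝ → ℂ × ℂ := fun z => (α z - α0, β z - β0)
  have dv : ∀ z, HasDerivAt v (α' z, β' z) z := fun z =>
    ((dα z).sub_const α0).prodMk ((dβ z).sub_const β0)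
  have hv0 : ‖v 0‖ ≤ 0 := by simp [v, α, β, hα0, hβ0]
  have bound : ∀ z ∈ Ico 0 T, ‖((α' z, β' z) : ℂ × ℂ)‖ ≤ k * ‖v z‖ + k * B := by
    intro z hz
    obtain ⟨n1, n2⟩ := norm_exp_le him hz.1 hz.2.le
    have hα : ‖α z‖ ≤ ‖v z‖ + B := by
      have h1 : ‖α z - α0‖ ≤ ‖v z‖ := norm_fst_le (v z)
      have h2 := norm_add_le (α z - α0) α0
      rw [sub_add_cancel] at h2
      linarith
    have hβ : ‖β z‖ ≤ ‖v z‖ + B := by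
      have h1 : ‖β z - β0‖ ≤ ‖v z‖ := norm_snd_le (v z)
      have h2 := norm_add_le (β z - β0) β0
      rw [sub_add_cancel] at h2
      linarith
    have hyz : 2 * Complex.I * s * y z = Complex.exp (Complex.I * s * z) * α z
        - Complex.exp (-(Complex.I * s * z)) * β z := by
      have : Complex.exp (Complex.I * s * z) * Complex.exp (-(Complex.I * s * z)) = 1 := by
        rw [← Complex.exp_add]; simp
      simp only [α, β]
      linear_combination (-2 * Complex.I * s * y z) * this
    have hny : ‖s‖ * ‖y z‖ ≤ Real.exp T * (‖v z‖ + B) := by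
      have h1 : ‖2 * Complex.I * s * y z‖ = 2 * (‖s‖ * ‖y z‖) := by simp; ring
      have h2 := norm_sub_le (Complex.exp (Complex.I * s * z) * α z)
        (Complex.exp (-(Complex.I * s * z)) * β z)
      rw [← hyz, h1, norm_mul _ (α z), norm_mul _ (β z)] at h2
      have h3 := mul_le_mul n1 hα (norm_nonneg _) (Real.exp_pos T).le
      have h4 := mul_le_mul n2 hβ (norm_nonneg _) (Real.exp_pos T).le
      linarith
    have hny' : ‖y z‖ ≤ Real.exp T * (‖v z‖ + B) / ‖s‖ := by
      rw [le_div_iff₀ hs0]; linarith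
    have fin : ∀ e : ℂ, ‖e‖ ≤ Real.exp T → ‖e * (- P z * y z)‖ ≤ k * ‖v z‖ + k * B := by
      intro e he
      rw [norm_mul, norm_mul, norm_neg, Complex.norm_real, Real.norm_eq_abs]
      have hAz := hA z hz.1 hz.2.le
      calc ‖e‖ * (|P z| * ‖y z‖) ≤ Real.exp T * (A * (Real.exp T * (‖v z‖ + B) / ‖s‖)) := by
            gcongr
        _ = _ := by rw [hk]; ring
    exact norm_prod_le_iff.2 ⟨fin _ n2, fin _ n1⟩
  have gr := norm_le_gronwallBound_of_norm_deriv_right_le (f := v) (f' := fun z => (α' z, β' z))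
    (δ := 0) (K := k) (ε := k * B) (a := 0) (b := T)
    (fun z _ => (dv z).continuousAt.continuousWithinAt) (fun z _ => (dv z).hasDerivWithinAt)
    hv0 bound T ⟨hT.le, le_rfl⟩
  rw [gronwallBound_of_K_ne_0 hkpos.ne'] at gr
  have fin : ‖v T‖ ≤ B * (A * Real.exp T ^ 2 * T * Real.exp (A * Real.exp T ^ 2 * T) / ‖s‖) := by
    refine gr.trans ?_
    have h1 : Real.exp (k * T) - 1 ≤ k * T * Real.exp (k * T) := by
      have := Real.add_one_le_exp (-(k * T))
      have h2 : Real.exp (-(k * T)) * Real.exp (k * T) = 1 := by rw [← Real.exp_add]; simp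
      have h3 := mul_le_mul_of_nonneg_right this (Real.exp_pos (k * T)).le
      rw [h2] at h3
      linarith
    have h2 : k ≤ A * Real.exp T ^ 2 := div_le_self (by positivity) hs
    have h3 : k * T * Real.exp (k * T) ≤ k * T * Real.exp (A * Real.exp T ^ 2 * T) := by
      gcongr
    have h4 : k * B / k = B := by field_simp
    simp only [zero_mul, zero_add, sub_zero]
    rw [h4]
    calc B * (Real.exp (k * T) - 1) ≤ B * (k * T * Real.exp (A * Real.exp T ^ 2 * T)) :=
          mul_le_mul_of_nonneg_left (h1.trans h3) hB
      _ = _ := by rw [hk]; ring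
  exact ⟨(norm_fst_le (v T)).trans fin, (norm_snd_le (v T)).trans fin⟩

lemma disc_asym {P : ℝ → ℝ} {T A : ℝ} (hT : 0 < T) (hA0 : 0 < A)
    (hA : ∀ t, 0 ≤ t → t ≤ T → |P t| ≤ A) :
    ∃ K : ℝ, ∀ s : ℂ, |s.im| ≤ 1 → 1 ≤ ‖s‖ → ∀ Y1 Y1d Y2 Y2d : ℝ → ℂ,
      IsFundC (fun z => -s ^ 2 - P z) Y1 Y1d Y2 Y2d →
      ‖Y1 T + Y2d T - 2 * Complex.cos (s * T)‖ ≤ K / ‖s‖ := by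
  set K := A * Real.exp T ^ 2 * T * Real.exp (A * Real.exp T ^ 2 * T) with hK
  refine ⟨Real.exp T * K + Real.exp T * K, fun s him hs Y1 Y1d Y2 Y2d h => ?_⟩
  have hs0 : 0 < ‖s‖ := by linarith
  have hsne : s ≠ 0 := norm_pos_iff.1 hs0
  obtain ⟨n1, n2⟩ := norm_exp_le him hT.le le_rfl
  obtain ⟨p1, p2⟩ := sol_asym hT hA0 hA him hs h.s1 (B := ‖s‖) (by simp [h.a1, h.b1])
    (by simp [h.a1, h.b1])
  obtain ⟨q1, q2⟩ := sol_asym hT hA0 hA him hs h.s2 (B := 1) (by simp [h.a2, h.b2])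
    (by simp [h.a2, h.b2])
  rw [← hK] at p1 p2 q1 q2
  have ee : Complex.exp (Complex.I * s * T) * Complex.exp (-(Complex.I * s * T)) = 1 := by
    rw [← Complex.exp_add]; simp
  have hcos : 2 * Complex.cos (s * T) = Complex.exp (Complex.I * s * T) +
      Complex.exp (-(Complex.I * s * T)) := by
    rw [Complex.cos]
    have : s * T * Complex.I = Complex.I * s * T := by ring
    have h2 : -(s * T) * Complex.I = -(Complex.I * s * T) := by ring
    rw [this, h2]; ring
  have comb : ∀ (a b : ℂ) (B : ℝ), ‖a‖ ≤ B → ‖b‖ ≤ B →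
      ‖Complex.exp (Complex.I * s * T) * a‖ ≤ Real.exp T * B ∧
      ‖Complex.exp (-(Complex.I * s * T)) * b‖ ≤ Real.exp T * B := by
    intro a b B ha hb
    rw [norm_mul, norm_mul]
    exact ⟨mul_le_mul n1 ha (norm_nonneg _) (Real.exp_pos T).le,
      mul_le_mul n2 hb (norm_nonneg _) (Real.exp_pos T).le⟩
  have e1 : ‖Y1 T - Complex.cos (s * T)‖ ≤ Real.exp T * K / ‖s‖ := by
    have c := comb _ _ _ p1 p2
    have h2 := (norm_sub_le _ _).trans (add_le_add c.1 c.2)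
    have : 2 * Complex.I * s * (Y1 T - Complex.cos (s * T)) =
      Complex.exp (Complex.I * s * T) * (Complex.exp (-(Complex.I * s * T)) *
        (Y1d T + Complex.I * s * Y1 T) - (Y1d 0 + Complex.I * s * Y1 0)) -
      Complex.exp (-(Complex.I * s * T)) * (Complex.exp (Complex.I * s * T) *
        (Y1d T - Complex.I * s * Y1 T) - (Y1d 0 - Complex.I * s * Y1 0)) := by
      rw [h.a1, h.b1]
      linear_combination (-(Complex.I * s)) * hcos - (2 * Complex.I * s * Y1 T) * ee
    rw [← this] at h2
    have h3 : ‖2 * Complex.I * s * (Y1 T - Complex.cos (s * T))‖ =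
      2 * ‖s‖ * ‖Y1 T - Complex.cos (s * T)‖ := by simp
    rw [h3] at h2
    have h4 : ‖s‖ * (K / ‖s‖) = K := by field_simp
    rw [h4] at h2
    rw [le_div_iff₀ hs0]; linarith
  have e2 : ‖Y2d T - Complex.cos (s * T)‖ ≤ Real.exp T * K / ‖s‖ := by
    have c := comb _ _ _ q1 q2
    have h2 := (norm_add_le _ _).trans (add_le_add c.1 c.2)
    have : 2 * (Y2d T - Complex.cos (s * T)) =
      Complex.exp (Complex.I * s * T) * (Complex.exp (-(Complex.I * s * T)) *
        (Y2d T + Complex.I * s * Y2 T) - (Y2d 0 + Complex.I * s * Y2 0)) +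
      Complex.exp (-(Complex.I * s * T)) * (Complex.exp (Complex.I * s * T) *
        (Y2d T - Complex.I * s * Y2 T) - (Y2d 0 - Complex.I * s * Y2 0)) := by
      rw [h.a2, h.b2]
      linear_combination (-1 : ℂ) * hcos - (2 * Y2d T) * ee
    rw [← this] at h2
    have h3 : ‖2 * (Y2d T - Complex.cos (s * T))‖ = 2 * ‖Y2d T - Complex.cos (s * T)‖ := by simp
    rw [h3] at h2
    have : Real.exp T * K / ‖s‖ = Real.exp T * (1 * (K / ‖s‖)) := by ring
    rw [this]; linarith
  have : Y1 T + Y2d T - 2 * Complex.cos (s * T) =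
    (Y1 T - Complex.cos (s * T)) + (Y2d T - Complex.cos (s * T)) := by ring
  rw [this, add_div]
  exact (norm_add_le _ _).trans (add_le_add e1 e2)

/-! ### Leaving the real axis -/

/-- sign function for the ellipse condition -/
def ellPhi (h : ℂ → ℂ) (τ x ε : ℝ) : ℝ :=
  (h (x + ε * Complex.I)).re ^ 2 * Real.sinh (τ * ε) ^ 2
    + (h (x + ε * Complex.I)).im ^ 2 * Real.cosh (τ * ε) ^ 2
    - 4 * Real.sinh (τ * ε) ^ 2 * Real.cosh (τ * ε) ^ 2

def ellF (h : ℂ → ℂ) (τ x : ℝ) : ℝ :=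
  (deriv h x).re ^ 2 - τ ^ 2 * (4 - (h x).re ^ 2)

lemma ellPhi_zero {h : ℂ → ℂ} {τ x ε : ℝ} (hτ : τ ≠ 0) (hε : ε ≠ 0) (h0 : ellPhi h τ x ε = 0) :
    ∃ ρ : ℂ, ‖ρ‖ = Real.exp (τ * ε) ∧ h (x + ε * Complex.I) = ρ + ρ⁻¹ := by
  set D := h (x + ε * Complex.I) with hD
  have hsn : Real.sinh (τ * ε) ≠ 0 := by
    rw [Ne, Real.sinh_eq_zero]; exact mul_ne_zero hτ hε
  have hcs : Real.cosh (τ * ε) ≠ 0 := (Real.cosh_pos _).ne'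
  set p := D.re / (2 * Real.cosh (τ * ε)) with hp
  set q := D.im / (2 * Real.sinh (τ * ε)) with hq
  have hpq : p ^ 2 + q ^ 2 = 1 := by
    rw [hp, hq]
    unfold ellPhi at h0
    rw [← hD] at h0
    field_simp
    linear_combination h0
  have hDre : D.re = 2 * Real.cosh (τ * ε) * p := by rw [hp]; field_simp
  have hDim : D.im = 2 * Real.sinh (τ * ε) * q := by rw [hq]; field_simp
  have hu : ((p : ℂ) + q * Complex.I) * ((p : ℂ) - q * Complex.I) = 1 := by
    have : ((p ^ 2 + q ^ 2 : ℝ) : ℂ) = 1 := by rw [hpq]; simp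
    push_cast at this
    linear_combination this - (q : ℂ) ^ 2 * Complex.I_sq
  have hnu : ‖(p : ℂ) + q * Complex.I‖ = 1 := by
    rw [Complex.norm_add_mul_I, hpq, Real.sqrt_one]
  refine ⟨(Real.exp (τ * ε) : ℂ) * (p + q * Complex.I), ?_, ?_⟩
  · rw [norm_mul, hnu, Complex.norm_real, Real.norm_of_nonneg (Real.exp_pos _).le, mul_one]
  · have hinv : ((Real.exp (τ * ε) : ℂ) * (p + q * Complex.I))⁻¹ =
        (Real.exp (-(τ * ε)) : ℂ) * (p - q * Complex.I) := by
      rw [mul_inv, inv_eq_of_mul_eq_one_right hu, Real.exp_neg]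
      push_cast; rfl
    rw [hinv]
    rw [Real.cosh_eq] at hDre
    rw [Real.sinh_eq] at hDim
    apply Complex.ext
    · rw [hDre]
      simp only [Complex.add_re, Complex.re_ofReal_mul, Complex.sub_re, Complex.ofReal_re,
        Complex.mul_I_re, Complex.ofReal_im]
      ring
    · rw [hDim]
      simp only [Complex.add_im, Complex.im_ofReal_mul, Complex.sub_im, Complex.ofReal_re,
        Complex.mul_I_im, Complex.ofReal_im]
      ring

lemma ellPhi_lim {h : ℂ → ℂ} (hd : Differentiable ℂ h) (hr : ∀ x : ℝ, (h x).im = 0) (τ x : ℝ) :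
    Tendsto (fun ε => ellPhi h τ x ε / ε ^ 2) (nhdsWithin 0 (Ioi 0)) (nhds (ellF h τ x)) := by
  have hle : nhdsWithin (0:ℝ) (Ioi 0) ≤ nhdsWithin 0 {0}ᶜ :=
    nhdsWithin_mono _ fun y hy => ne_of_gt hy
  have hline : HasDerivAt (fun ε : ℝ => h (x + ε * Complex.I)) (deriv h x * Complex.I) 0 := by
    have h1 : HasDerivAt (fun ε : ℝ => (x : ℂ) + ε * Complex.I) Complex.I 0 := by
      simpa using ((Complex.ofRealCLM.hasDerivAt (x := (0:ℝ))).mul_const Complex.I).const_add (x : ℂ)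
    have h2 : HasDerivAt h (deriv h x) ((x : ℂ) + (0:ℝ) * Complex.I) := by
      simpa using (hd x).hasDerivAt
    exact h2.comp (0:ℝ) h1
  have him : HasDerivAt (fun ε : ℝ => (h (x + ε * Complex.I)).im) (deriv h x).re 0 := by
    have := (Complex.imCLM.hasFDerivAt.comp_hasDerivAt (0:ℝ) hline)
    exact this.congr_deriv (by simp)
  have hre : Tendsto (fun ε : ℝ => (h (x + ε * Complex.I)).re) (nhdsWithin 0 (Ioi 0))
      (nhds (h x).re) := by
    have := (Complex.continuous_re.continuousAt.comp hline.continuousAt).tendsto.mono_left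
      (nhdsWithin_le_nhds (s := Ioi 0))
    simpa [Function.comp_def] using this
  have hsh : HasDerivAt (fun ε : ℝ => Real.sinh (τ * ε)) τ 0 := by
    have := ((hasDerivAt_id (0:ℝ)).const_mul τ).sinh
    simpa using this
  have l1 := (hasDerivAt_iff_tendsto_slope.1 him).mono_left hle
  have l2 := (hasDerivAt_iff_tendsto_slope.1 hsh).mono_left hle
  have l3 : Tendsto (fun ε : ℝ => Real.cosh (τ * ε)) (nhdsWithin 0 (Ioi 0)) (nhds 1) := by
    have : Continuous fun ε : ℝ => Real.cosh (τ * ε) := by fun_prop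
    have := (this.tendsto 0).mono_left (nhdsWithin_le_nhds (s := Ioi 0))
    simpa using this
  have big := (((hre.pow 2).mul (l2.pow 2)).add ((l1.pow 2).mul (l3.pow 2))).sub
    (((l2.pow 2).const_mul 4).mul (l3.pow 2))
  have hval : (h x).re ^ 2 * τ ^ 2 + (deriv h x).re ^ 2 * 1 ^ 2 - 4 * τ ^ 2 * 1 ^ 2 = ellF h τ x := by
    unfold ellF; ring
  rw [hval] at big
  refine big.congr' ?_
  filter_upwards [self_mem_nhdsWithin] with ε hε
  have hε0 : ε ≠ 0 := ne_of_gt hε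
  have hi0 : (h (x + (0:ℝ) * Complex.I)).im = 0 := by simpa using hr x
  simp only [slope_def_field, hi0, sub_zero, mul_zero, Real.sinh_zero]
  unfold ellPhi
  field_simp

lemma off_axis {h : ℂ → ℂ} (hd : Differentiable ℂ h) (hr : ∀ x : ℝ, (h x).im = 0) {τ : ℝ}
    (hτ : τ ≠ 0) {κ a b : ℝ} (ha : 0 < a) (hb : 0 < b) (hFa : 0 < κ * ellF h τ a)
    (hFb : κ * ellF h τ b < 0) :
    ∃ x : ℝ, 0 < x ∧ ∀ U ∈ nhds (x : ℂ), ∃ s ∈ U, s.im ≠ 0 ∧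
      ∃ ρ : ℂ, ‖ρ‖ = Real.exp (τ * s.im) ∧ h s = ρ + ρ⁻¹ := by
  have ea : ∀ᶠ ε in nhdsWithin (0:ℝ) (Ioi 0), 0 < κ * (ellPhi h τ a ε / ε ^ 2) :=
    ((ellPhi_lim hd hr τ a).const_mul κ).eventually_const_lt hFa
  have eb : ∀ᶠ ε in nhdsWithin (0:ℝ) (Ioi 0), κ * (ellPhi h τ b ε / ε ^ 2) < 0 :=
    ((ellPhi_lim hd hr τ b).const_mul κ).eventually_lt_const hFb
  have ex : ∀ᶠ ε in nhdsWithin (0:ℝ) (Ioi 0), 0 < ε ∧ ∃ x ∈ uIcc a b, ellPhi h τ x ε = 0 := by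
    filter_upwards [ea, eb, self_mem_nhdsWithin] with ε h1 h2 hε
    have hε : 0 < ε := hε
    refine ⟨hε, ?_⟩
    have hcont : Continuous fun x : ℝ => κ * (ellPhi h τ x ε / ε ^ 2) := by
      have := hd.continuous
      unfold ellPhi
      fun_prop
    obtain ⟨x, hx, hx0⟩ := intermediate_value_uIcc (a := a) (b := b) hcont.continuousOn
      (show (0:ℝ) ∈ _ from mem_uIcc.2 (Or.inr ⟨h2.le, h1.le⟩))
    refine ⟨x, hx, ?_⟩
    have hκ : κ ≠ 0 := by rintro rfl; simp at hFa
    have hx0 : κ * (ellPhi h τ x ε / ε ^ 2) = 0 := hx0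
    rcases mul_eq_zero.1 hx0 with h | h
    · exact absurd h hκ
    · rcases div_eq_zero_iff.1 h with h | h
      · exact h
      · exact absurd h (by positivity)
  have sq : Tendsto (fun n : ℕ => 1 / ((n : ℝ) + 1)) atTop (nhdsWithin 0 (Ioi 0)) :=
    tendsto_nhdsWithin_iff.2 ⟨tendsto_one_div_add_atTop_nhds_zero_nat,
      Eventually.of_forall fun n => by simp only [mem_Ioi]; positivity⟩
  obtain ⟨N, hN⟩ := eventually_atTop.1 (sq.eventually ex)
  let e : ℕ → ℝ := fun n => 1 / (((n + N : ℕ) : ℝ) + 1)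
  have he : ∀ n, 0 < e n ∧ ∃ x ∈ uIcc a b, ellPhi h τ x (e n) = 0 := fun n => hN (n + N) (by omega)
  have hlim : Tendsto e atTop (nhds 0) :=
    (tendsto_add_atTop_iff_nat N).2 tendsto_one_div_add_atTop_nhds_zero_nat
  choose he0 xs hxs hzero using he
  obtain ⟨x, hx, φ, hφ, hxlim⟩ := isCompact_uIcc.tendsto_subseq hxs
  refine ⟨x, lt_of_lt_of_le (lt_min ha hb) hx.1, fun U hU => ?_⟩
  have hs : Tendsto (fun n => (xs (φ n) : ℂ) + (e (φ n) : ℂ) * Complex.I) atTop (nhds (x : ℂ)) := by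
    have h1 : Tendsto (fun n => ((xs (φ n) : ℝ) : ℂ)) atTop (nhds (x : ℂ)) :=
      (Complex.continuous_ofReal.tendsto x).comp hxlim
    have h2 : Tendsto (fun n => ((e (φ n) : ℝ) : ℂ)) atTop (nhds ((0:ℝ) : ℂ)) :=
      (Complex.continuous_ofReal.tendsto 0).comp (hlim.comp hφ.tendsto_atTop)
    have := h1.add (h2.mul_const Complex.I)
    simpa using this
  obtain ⟨n, hn⟩ := (hs.eventually hU).exists
  have him : ((xs (φ n) : ℂ) + (e (φ n) : ℂ) * Complex.I).im = e (φ n) := by simp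
  refine ⟨_, hn, ?_, ?_⟩
  · rw [him]; exact (he0 _).ne'
  · rw [him]
    exact ellPhi_zero hτ (he0 _).ne' (hzero _)

/-! ### Signs at the two ends -/

lemma ellF_near_zero {D : ℂ → ℂ} (hD : Differentiable ℂ D) 
    (h2 : (D 0).re = 2) (τ : ℝ) :
    Tendsto (fun x : ℝ => ellF (fun s => D (-s ^ 2)) τ x / x ^ 2) (nhdsWithin 0 (Ioi 0))
      (nhds (4 * (deriv D 0).re ^ 2 - 4 * τ ^ 2 * (deriv D 0).re)) := by
  have hdre : ∀ x : ℝ, HasDerivAt (fun y : ℝ => (D y).re) (deriv D x).re x := fun x =>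
    HasDerivAt.real_of_complex (hD x).hasDerivAt
  have hder : ∀ x : ℝ, deriv (fun s => D (-s ^ 2)) (x : ℂ) = deriv D ((-x ^ 2 : ℝ) : ℂ) * (-(2 * x)) := by
    intro x
    have h1 : HasDerivAt (fun s : ℂ => -s ^ 2) (-(2 * (x : ℂ))) x := by
      exact (hasDerivAt_pow 2 (x : ℂ)).neg.congr_deriv (by simp)
    have h2 := ((hD (-(x : ℂ) ^ 2)).hasDerivAt.comp (x : ℂ) h1).deriv
    simp only [Function.comp_def] at h2
    rw [h2]; push_cast; rfl
  have hsq : Tendsto (fun x : ℝ => -x ^ 2) (nhdsWithin 0 (Ioi 0)) (nhdsWithin 0 {0}ᶜ) := by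
    refine tendsto_nhdsWithin_iff.2 ⟨?_, ?_⟩
    · have : Continuous fun x : ℝ => -x ^ 2 := by fun_prop
      simpa using (this.tendsto 0).mono_left (nhdsWithin_le_nhds (s := Ioi 0))
    · filter_upwards [self_mem_nhdsWithin] with x hx
      have hx : 0 < x := hx
      simp [hx.ne']
  have l1 : Tendsto (fun x : ℝ => slope (fun y : ℝ => (D y).re) 0 (-x ^ 2)) (nhdsWithin 0 (Ioi 0))
      (nhds (deriv D 0).re) := by
    have := (hasDerivAt_iff_tendsto_slope.1 (hdre 0)).comp hsq
    simpa [Function.comp_def] using this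
  have l2 : Tendsto (fun x : ℝ => (deriv D ((-x ^ 2 : ℝ) : ℂ)).re) (nhdsWithin 0 (Ioi 0))
      (nhds (deriv D 0).re) := by
    have hc : Continuous fun y : ℝ => (deriv D (y : ℂ)).re := by
      have : Continuous (deriv D) := (hD.contDiff (n := 1)).continuous_deriv le_rfl
      fun_prop
    have := (hc.tendsto 0).comp (hsq.mono_right nhdsWithin_le_nhds)
    simpa [Function.comp_def] using this
  have l3 : Tendsto (fun x : ℝ => (D ((-x ^ 2 : ℝ) : ℂ)).re) (nhdsWithin 0 (Ioi 0)) (nhds 2) := by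
    have hc : Continuous fun y : ℝ => (D (y : ℂ)).re := by
      have := hD.continuous
      fun_prop
    have := (hc.tendsto 0).comp (hsq.mono_right nhdsWithin_le_nhds)
    simpa [Function.comp_def, h2] using this
  have big := ((l2.pow 2).const_mul 4).sub (((l3.add_const 2).mul l1).const_mul (τ ^ 2))
  have hval : 4 * (deriv D 0).re ^ 2 - τ ^ 2 * ((2 + 2) * (deriv D 0).re) =
    4 * (deriv D 0).re ^ 2 - 4 * τ ^ 2 * (deriv D 0).re := by ring
  rw [hval] at big
  refine big.congr' ?_
  filter_upwards [self_mem_nhdsWithin] with x hx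
  have hx0 : x ≠ 0 := ne_of_gt hx
  unfold ellF
  rw [hder]
  have e1 : (-(2 * (x : ℂ))) = ((-(2 * x) : ℝ) : ℂ) := by push_cast; ring
  have e2 : (D (-(x : ℂ) ^ 2)) = D ((-x ^ 2 : ℝ) : ℂ) := by push_cast; rfl
  rw [e1, Complex.re_mul_ofReal, slope_def_field]
  simp only [e2]
  simp only [Complex.ofReal_zero, h2]
  field_simp
  ring

lemma ellF_far {h : ℂ → ℂ} (hd : Differentiable ℂ h) {T K : ℝ} (hT : 0 < T)
    (hK : ∀ s : ℂ, |s.im| ≤ 1 → 1 ≤ ‖s‖ → ‖h s - 2 * Complex.cos (s * T)‖ ≤ K / ‖s‖) (τ : ℝ) :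
    Tendsto (fun n : ℕ => ellF h τ ((π / 2 + n * (2 * π)) / T)) atTop
      (nhds (4 * T ^ 2 - 4 * τ ^ 2)) := by
  set x : ℕ → ℝ := fun n => (π / 2 + n * (2 * π)) / T with hx
  have hxlim : Tendsto x atTop atTop := by
    apply Tendsto.atTop_div_const hT
    apply tendsto_atTop_add_const_left
    exact tendsto_natCast_atTop_atTop.atTop_mul_const (by positivity)
  have hxT : ∀ n, x n * T = π / 2 + n * (2 * π) := fun n => by rw [hx]; field_simp
  have hcos : ∀ n, Complex.cos ((x n : ℂ) * T) = 0 := by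
    intro n
    rw [← Complex.ofReal_mul, hxT, ← Complex.ofReal_cos, Real.cos_add_nat_mul_two_pi,
      Real.cos_pi_div_two]; simp
  have hsin : ∀ n, Complex.sin ((x n : ℂ) * T) = 1 := by
    intro n
    rw [← Complex.ofReal_mul, hxT, ← Complex.ofReal_sin, Real.sin_add_nat_mul_two_pi,
      Real.sin_pi_div_two]; simp
  have hg : Differentiable ℂ fun s : ℂ => h s - 2 * Complex.cos (s * T) := by fun_prop
  have hK0 : 0 ≤ K := by
    have := (norm_nonneg _).trans (hK 1 (by simp) (by simp))
    simpa using this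
  have hlimK : Tendsto (fun n => K / (x n - 1)) atTop (nhds 0) :=
    (tendsto_atTop_add_const_right _ (-1) hxlim).const_div_atTop K
  have t1 : Tendsto (fun n => (h (x n)).re) atTop (nhds 0) := by
    refine squeeze_zero_norm' ?_ hlimK
    filter_upwards [hxlim.eventually_ge_atTop 2] with n hn
    have := hK (x n) (by simp) (by rw [Complex.norm_real, Real.norm_of_nonneg (by linarith)]; linarith)
    rw [hcos, mul_zero, sub_zero, Complex.norm_real, Real.norm_of_nonneg (by linarith)] at this
    refine (Complex.abs_re_le_norm _).trans (this.trans ?_)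
    apply div_le_div_of_nonneg_left hK0 <;> linarith
  have t2 : Tendsto (fun n => (deriv h (x n)).re + 2 * T) atTop (nhds 0) := by
    refine squeeze_zero_norm' ?_ hlimK
    filter_upwards [hxlim.eventually_ge_atTop 2] with n hn
    have hbd : ∀ s ∈ Metric.sphere (x n : ℂ) 1, ‖h s - 2 * Complex.cos (s * T)‖ ≤ K / (x n - 1) := by
      intro s hs
      have hs1 : ‖s - x n‖ = 1 := by simpa [dist_eq_norm] using hs
      have him : |s.im| ≤ 1 := by
        have := Complex.abs_im_le_norm (s - x n)
        simpa [hs1] using this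
      have hns : x n - 1 ≤ ‖s‖ := by
        have := norm_sub_norm_le (x n : ℂ) s
        rw [norm_sub_rev, hs1, Complex.norm_real, Real.norm_of_nonneg (by linarith)] at this
        linarith
      refine (hK s him (by linarith)).trans ?_
      apply div_le_div_of_nonneg_left hK0 <;> linarith
    have hc := Complex.norm_deriv_le_of_forall_mem_sphere_norm_le (c := (x n : ℂ)) (R := 1) one_pos
      hg.diffContOnCl hbd
    have hder : deriv (fun s : ℂ => h s - 2 * Complex.cos (s * T)) (x n) = deriv h (x n) + 2 * T := by
      have h1 : HasDerivAt (fun s : ℂ => s * (T : ℂ)) (T : ℂ) (x n) := by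
        simpa using (hasDerivAt_id (x n : ℂ)).mul_const (T : ℂ)
      have := ((hd (x n)).hasDerivAt.sub (h1.ccos.const_mul 2)).deriv
      change deriv (fun s : ℂ => h s - 2 * Complex.cos (s * T)) (x n) = _ at this
      rw [this, hsin]; ring
    rw [hder, div_one] at hc
    refine le_trans ?_ hc
    have := Complex.abs_re_le_norm (deriv h (x n) + 2 * T)
    simpa using this
  have t3 : Tendsto (fun n => (deriv h (x n)).re) atTop (nhds (-(2 * T))) := by
    have := t2.sub_const (2 * T)
    simpa using this
  have big := (t3.pow 2).sub (((t1.pow 2).const_sub 4).const_mul (τ ^ 2))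
  have : (-(2 * T)) ^ 2 - τ ^ 2 * (4 - 0 ^ 2) = 4 * T ^ 2 - 4 * τ ^ 2 := by ring
  rw [this] at big
  exact big

/-! ### The Klein–Gordon part -/

lemma kg_mem {c : ℝ} (hc : c ^ 2 ≠ 1) {Q P : ℝ → ℝ} (hP : P = fun z => Q z / (c ^ 2 - 1))
    {T : ℝ} (hT : 0 < T) (hPer : ∀ z, P (z + T) = P z) {s : ℂ} {Y1 Y1d Y2 Y2d : ℝ → ℂ}
    (hF : IsFundC (fun z => -s ^ 2 - P z) Y1 Y1d Y2 Y2d) {ρ : ℂ}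
    (hn : ‖ρ‖ = Real.exp (c * T * s.im)) (hρ : Y1 T + Y2d T = ρ + ρ⁻¹) :
    Complex.I * (((c ^ 2 - 1 : ℝ) : ℂ) * s) ∈ KGSpectrum c Q := by
  have hκ : c ^ 2 - 1 ≠ 0 := sub_ne_zero.2 hc
  have hρ0 : ρ ≠ 0 := by
    rw [← norm_pos_iff, hn]; exact Real.exp_pos _
  obtain ⟨y, yd, hy, hfl, hne⟩ := hF.floquet T (fun z => by rw [hPer]) ρ hρ0 hρ
  set m : ℂ := c * Complex.I * s with hm
  have hlin : ∀ z : ℝ, HasDerivAt (fun z : ℝ => Complex.exp (m * (z : ℂ)))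
      (Complex.exp (m * z) * m) z := by
    intro z
    have : HasDerivAt (fun z : ℝ => m * (z : ℂ)) m z := by
      simpa using (Complex.ofRealCLM.hasDerivAt (x := z)).const_mul m
    exact this.cexp
  refine ⟨fun z => Complex.exp (m * z) * y z, fun z => Complex.exp (m * z) * (yd z + m * y z),
    fun z => Complex.exp (m * z) * ((-s ^ 2 - P z) * y z + 2 * m * yd z + m ^ 2 * y z), ?_, ?_, ?_, ?_, ?_⟩
  · intro z
    refine ((hlin z).mul (hy.1 z)).congr_deriv ?_
    ring
  · intro z
    refine ((hlin z).mul ((hy.2 z).add ((hy.1 z).const_mul m))).congr_deriv ?_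
    simp only [Pi.add_apply]
    ring
  · intro z
    have hQ : (Q z : ℂ) = ((c : ℂ) ^ 2 - 1) * P z := by
      have : Q z = (c ^ 2 - 1) * P z := by rw [hP]; field_simp
      rw [this]; push_cast; ring
    rw [hQ, hm]
    push_cast
    linear_combination (-(((c : ℂ) ^ 2 - 1) * s ^ 2 * Complex.exp (c * Complex.I * s * z) * y z)) * Complex.I_sq
  · obtain ⟨z, hz⟩ := hne
    exact ⟨z, mul_ne_zero (Complex.exp_ne_zero _) hz⟩
  · set g : ℝ → ℝ := fun z => ‖Complex.exp (m * z) * y z‖ with hg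
    have hper : Function.Periodic g T := by
      intro z
      simp only [hg]
      rw [hfl, Complex.ofReal_add, mul_add, Complex.exp_add, norm_mul, norm_mul, norm_mul, norm_mul, hn]
      have : ‖Complex.exp (m * T)‖ * Real.exp (c * T * s.im) = 1 := by
        rw [Complex.norm_exp, ← Real.exp_add]
        simp [hm]
        ring
      linear_combination (‖Complex.exp (m * z)‖ * ‖y z‖) * this
    have hcont : Continuous g := by
      have : Continuous y := continuous_iff_continuousAt.2 fun z => (hy.1 z).continuousAt
      simp only [hg]
      fun_prop
    obtain ⟨M, hM⟩ := (isCompact_Icc (a := (0:ℝ)) (b := T)).exists_bound_of_continuousOn hcont.continuousOn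
    refine ⟨M, fun z => ?_⟩
    obtain ⟨t, ht, hzt⟩ := hper.exists_mem_Ico₀ hT z
    change g z ≤ M
    rw [hzt]
    exact (le_abs_self _).trans (hM t ⟨ht.1, ht.2.le⟩)

/-- Periodicity of the potential. -/
lemma potential_periodic {W W' f fd fdd : ℝ → ℝ} (hW : ∀ u, HasDerivAt W (W' u) u) {k : ℝ}
    (hf : ∀ z, HasDerivAt f (fd z) z) (hfd : ∀ z, HasDerivAt fd (fdd z) z)
    (hwave : ∀ z, k * fdd z + W (f z) = 0) {T : ℝ} (hper : ∀ z, fd (z + T) = fd z) (z : ℝ) :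
    W' (f (z + T)) = W' (f z) := by
  have hA : ∀ z, f (z + T) = f z + (f (0 + T) - f 0) := by
    intro z
    have key : ∀ x, HasDerivAt (fun z => f (z + T) - f z) 0 x := by
      intro x
      refine (((hf (x + T)).comp_add_const x T).sub (hf x)).congr_deriv ?_
      rw [hper, sub_self]
    have := is_const_of_deriv_eq_zero (fun x => (key x).differentiableAt) (fun x => (key x).deriv) z 0
    linarith
  set A := f (0 + T) - f 0 with hAdef
  by_cases hA0 : A = 0
  · rw [hA, hA0, add_zero]
  have hfdd : ∀ z, fdd (z + T) = fdd z := by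
    intro z
    have h1 := (hfd (z + T)).comp_add_const z T
    have h2 : (fun z => fd (z + T)) = fd := funext hper
    rw [h2] at h1
    exact h1.unique (hfd z)
  have hWA : ∀ z, W (f z + A) = W (f z) := by
    intro z
    have h1 := hwave (z + T)
    rw [hfdd, hA z] at h1
    linarith [hwave z]
  have hn : ∀ n : ℕ, ∀ z, f (z + n * T) = f z + n * A := by
    intro n
    induction n with
    | zero => intro z; simp
    | succ n ih =>
      intro z
      have : z + ((n + 1 : ℕ) : ℝ) * T = (z + n * T) + T := by push_cast; ring
      rw [this, hA, ih]; push_cast; ring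
  have hsurj : ∀ u, ∃ z, f z = u := by
    intro u
    obtain ⟨n, hn'⟩ := exists_nat_gt (|u - f 0| / |A|)
    have hApos : 0 < |A| := abs_pos.2 hA0
    rw [div_lt_iff₀ hApos] at hn'
    have e1 : f (0 + n * T) = f 0 + n * A := hn n 0
    have e2 : f (0 - n * T) = f 0 - n * A := by
      have := hn n (0 - n * T)
      rw [sub_add_cancel] at this
      linarith
    have hu := abs_lt.1 hn'
    have hmem : u ∈ uIcc (f (0 - n * T)) (f (0 + n * T)) := by
      rw [e1, e2, mem_uIcc]
      rcases abs_cases A with ⟨h, _⟩ | ⟨h, _⟩ <;> rw [h] at hu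
      · left; constructor <;> linarith [hu.1, hu.2]
      · right; constructor <;> linarith [hu.1, hu.2]
    obtain ⟨x, -, hx⟩ := intermediate_value_uIcc (cont_of_deriv hf).continuousOn hmem
    exact ⟨x, hx⟩
  have hW2 : (fun u => W (u + A)) = W := by
    funext u
    obtain ⟨z, rfl⟩ := hsurj u
    exact hWA z
  have h1 := (hW (f z + A)).comp_add_const (f z) A
  rw [hW2] at h1
  rw [hA]
  exact h1.unique (hW (f z))

lemma hillFund_complex {P : ℝ → ℝ} {y1 y1d y2 y2d : ℝ → ℝ → ℝ}
    (hfund : IsHillFundamental P y1 y1d y2 y2d) (ν : ℝ) :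
    IsFundC (fun z => (ν : ℂ) - P z) (fun z => (y1 ν z : ℂ)) (fun z => (y1d ν z : ℂ))
      (fun z => (y2 ν z : ℂ)) (fun z => (y2d ν z : ℂ)) := by
  obtain ⟨h1, h1d, h2, h2d, a1, b1, a2, b2⟩ := hfund ν
  refine ⟨⟨fun z => (h1 z).ofReal_comp, fun z => (h1d z).ofReal_comp.congr_deriv ?_⟩,
    ⟨fun z => (h2 z).ofReal_comp, fun z => (h2d z).ofReal_comp.congr_deriv ?_⟩, ?_, ?_, ?_, ?_⟩
  · push_cast; ring
  · push_cast; ring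
  all_goals simp [a1, b1, a2, b2]

theorem dhh_exists_of_index_product_negative
    (V : ℝ → ℝ) (hV : ContDiff ℝ 2 V)
    (c : ℝ) (hc : c ^ 2 ≠ 1)
    (f fd fdd : ℝ → ℝ)
    (hf : ∀ z, HasDerivAt f (fd z) z)
    (hfd : ∀ z, HasDerivAt fd (fdd z) z)
    (hwave : ∀ z, (c ^ 2 - 1) * fdd z + deriv V (f z) = 0)
    (T : ℝ) (hT : 0 < T)
    (hper : ∀ z, fd (z + T) = fd z)
    (hnt : ∃ z, fd z ≠ 0)
    (Q : ℝ → ℝ) (hQ : Q = fun z => deriv (deriv V) (f z))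
    (P : ℝ → ℝ) (hP : P = fun z => Q z / (c ^ 2 - 1))
    (y1 y1d y2 y2d : ℝ → ℝ → ℝ)
    (hfund : IsHillFundamental P y1 y1d y2 y2d)
    (Δ : ℝ → ℝ) (hΔ : Δ = fun ν => y1 ν T + y2d ν T)
    (hd0 : deriv Δ 0 ≠ 0)
    (hgen : deriv Δ 0 ≠ c ^ 2 * T ^ 2)
    (hprod : deriv Δ 0 * (c ^ 2 - 1) * (c ^ 2 * T ^ 2 - deriv Δ 0) < 0) :
    ∃ β : ℝ, β ≠ 0 ∧ HasDHHInstabilityAt c Q (Complex.I * β) := by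
  have hκ : c ^ 2 - 1 ≠ 0 := sub_ne_zero.2 hc
  -- regularity of `V`
  have hV1 : ContDiff ℝ 1 (deriv V) := by
    have : ContDiff ℝ (1 + 1) V := by simpa [one_add_one_eq_two] using hV
    exact (contDiff_succ_iff_deriv.1 this).2.2
  have hW : ∀ u, HasDerivAt (deriv V) (deriv (deriv V) u) u := fun u =>
    (hV1.differentiable one_ne_zero u).hasDerivAt
  have hWc : Continuous (deriv (deriv V)) := hV1.continuous_deriv le_rfl
  have hPc : Continuous P := by
    have := cont_of_deriv hf
    rw [hP, hQ]
    fun_prop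
  have hPer : ∀ z, P (z + T) = P z := by
    intro z
    rw [hP, hQ]
    simp only
    rw [potential_periodic hW hf hfd hwave hper z]
  -- fundamental solutions
  have hfc := hillFund_complex hfund
  have H : RealFund P (y1 0) (y1d 0) (y2 0) (y2d 0) := by
    obtain ⟨h1, h1d, h2, h2d, -, -, -, -⟩ := hfund 0
    refine ⟨h1, fun z => (h1d z).congr_deriv (by ring), h2, fun z => (h2d z).congr_deriv (by ring), ?_⟩
    intro z
    exact_mod_cast (hfc 0).det z
  let Y1 : ℂ → ℝ → ℂ := hillY (hillU (y1 0) (y2 0) (y1 0))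
  let Y1d : ℂ → ℝ → ℂ := hillY (hillUd (y1 0) (y1d 0) (y2 0) (y2d 0) (y1 0) (y1d 0))
  let Y2 : ℂ → ℝ → ℂ := hillY (hillU (y1 0) (y2 0) (y2 0))
  let Y2d : ℂ → ℝ → ℂ := hillY (hillUd (y1 0) (y1d 0) (y2 0) (y2d 0) (y2 0) (y2d 0))
  have hF : ∀ ν : ℂ, IsFundC (fun z => ν - P z) (Y1 ν) (Y1d ν) (Y2 ν) (Y2d ν) := by
    intro ν
    obtain ⟨-, -, -, -, a1, b1, a2, b2⟩ := hfund 0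
    have z1 := hillY_zero (y1 := y1 0) (y1d := y1d 0) (y2 := y2 0) (y2d := y2d 0) (u0 := y1 0)
      (u0d := y1d 0) ν
    have z2 := hillY_zero (y1 := y1 0) (y1d := y1d 0) (y2 := y2 0) (y2d := y2d 0) (u0 := y2 0)
      (u0d := y2d 0) ν
    refine ⟨hillY_sol hPc H H.h1 H.h1d ν, hillY_sol hPc H H.h2 H.h2d ν, ?_, ?_, ?_, ?_⟩
    · exact z1.1.trans (by simp [a1])
    · exact z1.2.trans (by simp [b1])
    · exact z2.1.trans (by simp [a2])
    · exact z2.2.trans (by simp [b2])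
  let D : ℂ → ℂ := fun ν => Y1 ν T + Y2d ν T
  have hD : Differentiable ℂ D := by
    obtain ⟨C, L, -, -, hb⟩ := hillU_bound' H H.h1 H.h1d |T|
    obtain ⟨C', L', -, -, hb'⟩ := hillU_bound' H H.h2 H.h2d |T|
    exact (hillY_entire fun n => (hb n T le_rfl).1).add (hillY_entire fun n => (hb' n T le_rfl).2)
  have hDr : ∀ ν : ℝ, D ν = (Δ ν : ℂ) := by
    intro ν
    have r1 := ((hF ν).rep (hfc ν).s1 T).1
    have r2 := ((hF ν).rep (hfc ν).s2 T).2
    rw [(hfc ν).a1, (hfc ν).b1] at r1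
    rw [(hfc ν).a2, (hfc ν).b2] at r2
    rw [hΔ]
    push_cast
    rw [r1, r2]
    simp [D]
  have hDim : ∀ ν : ℝ, (D ν).im = 0 := fun ν => by rw [hDr, Complex.ofReal_im]
  have hdD : (deriv D 0).re = deriv Δ 0 := by
    have h1 : HasDerivAt (fun y : ℝ => (D y).re) (deriv D (0:ℝ)).re 0 :=
      HasDerivAt.real_of_complex (hD ((0:ℝ) : ℂ)).hasDerivAt
    have h2 : (fun y : ℝ => (D y).re) = Δ := by
      funext y; rw [hDr, Complex.ofReal_re]
    rw [h2] at h1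
    rw [h1.deriv, Complex.ofReal_zero]
  -- `Δ 0 = 2`
  have hfdd : ∀ z, HasDerivAt fdd (- P z * fd z) z := by
    intro z
    have e : fdd = fun z => -(deriv V (f z)) / (c ^ 2 - 1) := by
      funext z
      rw [eq_div_iff hκ]
      linarith [hwave z]
    have h1 := (((hW (f z)).comp z (hf z)).neg).div_const (c ^ 2 - 1)
    rw [e]
    refine h1.congr_deriv ?_
    rw [hP, hQ]
    ring
  have hfddper : fdd T = fdd 0 := by
    have h1 := (hfd (0 + T)).comp_add_const 0 T
    have h2 : (fun z => fd (z + T)) = fd := funext hper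
    rw [h2, zero_add] at h1
    exact h1.unique (hfd 0)
  have hΔ0 : Δ 0 = 2 := by
    have hsol : IsSolC (fun z => ((0:ℝ) : ℂ) - P z) (fun z => (fd z : ℂ)) (fun z => (fdd z : ℂ)) :=
      ⟨fun z => (hfd z).ofReal_comp, fun z => (hfdd z).ofReal_comp.congr_deriv (by push_cast; ring)⟩
    have rep := (hfc 0).rep hsol
    have repT := rep T
    have hT0 : fd T = fd 0 := by simpa using hper 0
    have d := (hfc 0).det T
    rw [hT0, hfddper] at repT
    have r1 : fd 0 = fd 0 * y1 0 T + fdd 0 * y2 0 T := by exact_mod_cast repT.1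
    have r2 : fdd 0 = fd 0 * y1d 0 T + fdd 0 * y2d 0 T := by exact_mod_cast repT.2
    have d' : y1 0 T * y2d 0 T - y1d 0 T * y2 0 T = 1 := by exact_mod_cast d
    have p1 : fd 0 * (Δ 0 - 2) = 0 := by
      rw [hΔ]
      linear_combination (y2d 0 T - 1) * r1 - y2 0 T * r2 + fd 0 * d'
    have p2 : fdd 0 * (Δ 0 - 2) = 0 := by
      rw [hΔ]
      linear_combination (y1 0 T - 1) * r2 - y1d 0 T * r1 + fdd 0 * d'
    by_contra hne
    have hne' : Δ 0 - 2 ≠ 0 := sub_ne_zero.2 hne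
    have q1 : fd 0 = 0 := (mul_eq_zero.1 p1).resolve_right hne'
    have q2 : fdd 0 = 0 := (mul_eq_zero.1 p2).resolve_right hne'
    obtain ⟨z, hz⟩ := hnt
    have := (rep z).1
    rw [q1, q2] at this
    simp at this
    exact hz this
  -- the two signs
  have hc0 : c ≠ 0 := by
    rintro rfl
    nlinarith [sq_nonneg (deriv Δ 0)]
  have hτ : c * T ≠ 0 := mul_ne_zero hc0 hT.ne'
  let h : ℂ → ℂ := fun s => D (-s ^ 2)
  have hh : Differentiable ℂ h := by
    intro s
    have : DifferentiableAt ℂ (fun s : ℂ => -s ^ 2) s := by fun_prop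
    exact (hD _).comp s this
  have hhr : ∀ x : ℝ, (h x).im = 0 := by
    intro x
    have := hDim (-x ^ 2)
    push_cast at this
    exact this
  obtain ⟨a, ha0, ha⟩ : ∃ a : ℝ, 0 < a ∧ 0 < (c ^ 2 - 1) * ellF h (c * T) a := by
    have lim := (ellF_near_zero hD
      (by rw [← Complex.ofReal_zero, hDr, Complex.ofReal_re, hΔ0]) (c * T)).const_mul (c ^ 2 - 1)
    rw [hdD] at lim
    have hpos : 0 < (c ^ 2 - 1) * (4 * deriv Δ 0 ^ 2 - 4 * (c * T) ^ 2 * deriv Δ 0) := by nlinarith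
    obtain ⟨a, h1, h2⟩ := ((lim.eventually_const_lt hpos).and self_mem_nhdsWithin).exists
    have h2 : 0 < a := h2
    refine ⟨a, h2, ?_⟩
    have e : (c ^ 2 - 1) * ellF h (c * T) a =
        ((c ^ 2 - 1) * (ellF h (c * T) a / a ^ 2)) * a ^ 2 := by field_simp
    rw [e]
    exact mul_pos h1 (by positivity)
  obtain ⟨b, hb0, hb⟩ : ∃ b : ℝ, 0 < b ∧ (c ^ 2 - 1) * ellF h (c * T) b < 0 := by
    obtain ⟨A, hA0, hA⟩ := exists_abs_bound hPc T
    obtain ⟨K, hK⟩ := disc_asym (P := P) (A := A + 1) hT (by linarith)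
      (fun t h0 h1 => (hA t (by rwa [abs_of_nonneg h0])).trans (by linarith))
    have lim := (ellF_far hh hT (K := K) (fun s h1 h2 => hK s h1 h2 _ _ _ _ (hF (-s ^ 2)))
      (c * T)).const_mul (c ^ 2 - 1)
    have hneg : (c ^ 2 - 1) * (4 * T ^ 2 - 4 * (c * T) ^ 2) < 0 := by
      have h1 : 0 < (c ^ 2 - 1) ^ 2 := by positivity
      have h2 : 0 < T ^ 2 := by positivity
      nlinarith [mul_pos h1 h2]
    obtain ⟨n, hn⟩ := (lim.eventually_lt_const hneg).exists
    exact ⟨_, by positivity, hn⟩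
  obtain ⟨x, hx0, hx⟩ := off_axis hh hhr hτ ha0 hb0 ha hb
  refine ⟨(c ^ 2 - 1) * x, mul_ne_zero hκ hx0.ne', fun U hU => ?_⟩
  have hcont : Continuous fun s : ℂ => Complex.I * (((c ^ 2 - 1 : ℝ) : ℂ) * s) := by fun_prop
  have hU' : (fun s : ℂ => Complex.I * (((c ^ 2 - 1 : ℝ) : ℂ) * s)) ⁻¹' U ∈ nhds (x : ℂ) := by
    refine hcont.continuousAt.preimage_mem_nhds ?_
    convert hU using 2
    push_cast; ring
  obtain ⟨s, hsU, hsim, ρ, hρn, hρ⟩ := hx _ hU'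
  refine ⟨_, kg_mem hc hP hT hPer (hF (-s ^ 2)) hρn hρ, hsU, ?_⟩
  rw [Complex.I_mul_re, Complex.im_ofReal_mul]
  exact neg_ne_zero.2 (mul_ne_zero hκ hsim)
end
end
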